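/- arXiv:2409.11091 — 2 statements merged into one kernel-verified Lean document; each statement's English description precedes it below -/
import Mathlib

section
/- There is a universal constant C such that for any generic distribution D over valuation profiles and any ε, δ > 0, given k ≥ C·(1/ε²)·(m² + m·log n + log(1/δ)) i.i.d. sample valuation profiles from D, with probability at least 1 − δ the following holds: a (1/2 − ε)-median price vector for the empirical distribution over the samples exists, and every price vector that is (1/2 − ε)-median for the empirical distribution is (1/2 − 2ε)-median for D. -/
open scoped BigOperators

/-- A valuation is a real-valued set function on bundles of the `m` items. -/
abbrev Val (m : ℕ) := Finset (Fin m) → ℝ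

/-- A (normalized, monotone) valuation. -/
def IsValuation {m : ℕ} (v : Val m) : Prop :=
  v ∅ = 0 ∧ ∀ A B : Finset (Fin m), A ⊆ B → v A ≤ v B

/-- XOS (fractionally subadditive) valuations: a pointwise maximum of finitely many
nonnegative additive functions. -/
def IsXOS {m : ℕ} (v : Val m) : Prop :=
  ∃ (k : ℕ) (a : Fin (k + 1) → Fin m → ℝ),
    (∀ ℓ j, 0 ≤ a ℓ j) ∧ ∀ B : Finset (Fin m), v B = ⨆ ℓ, ∑ j ∈ B, a ℓ j

/-- An allocation: pairwise disjoint bundles. -/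
def IsAlloc {n m : ℕ} (A : Fin n → Finset (Fin m)) : Prop :=
  ∀ i i' : Fin n, i ≠ i' → Disjoint (A i) (A i')

/-- The optimal offline welfare of a valuation profile. -/
noncomputable def OPT {n m : ℕ} (v : Fin n → Val m) : ℝ :=
  ⨆ A : {A : Fin n → Finset (Fin m) // IsAlloc A}, ∑ i, v i (A.1 i)

/-- `B` is a demand set of valuation `v` at prices `p` among the available items `M`:
it maximizes the utility `v(B) - Σ_{j ∈ B} p j` over subsets of `M`. -/
def IsDemand {m : ℕ} (v : Val m) (p : Fin m → ℝ) (M : Finset (Fin m))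
    (B : Finset (Fin m)) : Prop :=
  B ⊆ M ∧ ∀ B' ⊆ M, v B' - ∑ j ∈ B', p j ≤ v B - ∑ j ∈ B, p j

/-- `a` is an additive supporting function of `v` on `B`. -/
def IsSupport {m : ℕ} (v : Val m) (B : Finset (Fin m)) (a : Fin m → ℝ) : Prop :=
  (∀ j, 0 ≤ a j) ∧ (∀ j, j ∉ B → a j = 0) ∧
  (∀ B' : Finset (Fin m), ∑ j ∈ B', a j ≤ v B') ∧ ∑ j ∈ B, a j = v B

/-- The least power of two that is at least `x` (by convention `0` for `x ≤ 0`). -/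
noncomputable def pow2ceil (x : ℝ) : ℝ :=
  if x ≤ 0 then 0 else (2 : ℝ) ^ (⌈Real.logb 2 x⌉ : ℤ)

open MeasureTheory
open scoped ENNReal

variable {n m : ℕ}

/-- The set of items still available after the first `i` buyers have bought, in the
sequential posted-price mechanism at prices `q`, where buyer `i` (with valuation
`v i`) buys the bundle `sel i (v i) q M` from the available items `M`. -/
def availN (sel : Fin n → Val m → (Fin m → ℝ) → Finset (Fin m) → Finset (Fin m))
    (q : Fin m → ℝ) (v : Fin n → Val m) : ℕ → Finset (Fin m)
  | 0 => Finset.univ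
  | i + 1 =>
      if h : i < n then
        availN sel q v i \ sel ⟨i, h⟩ (v ⟨i, h⟩) q (availN sel q v i)
      else availN sel q v i

/-- The set of items sold by the sequential posted-price mechanism. -/
def soldSet (sel : Fin n → Val m → (Fin m → ℝ) → Finset (Fin m) → Finset (Fin m))
    (q : Fin m → ℝ) (v : Fin n → Val m) : Finset (Fin m) :=
  Finset.univ \ availN sel q v n

/-- The bundle bought by buyer `i` in the sequential posted-price mechanism. -/
def buys (sel : Fin n → Val m → (Fin m → ℝ) → Finset (Fin m) → Finset (Fin m))
    (q : Fin m → ℝ) (v : Fin n → Val m) (i : Fin n) : Finset (Fin m) :=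
  sel i (v i) q (availN sel q v i.1)

/-- A distribution over single valuations is generic: for every price vector and every
set of available items, with probability zero there exist two distinct demand sets. -/
def Generic1 {m : ℕ} (D : Measure (Val m)) : Prop :=
  ∀ (q : Fin m → ℝ) (M : Finset (Fin m)),
    D {v : Val m | ∃ B1 B2 : Finset (Fin m),
      B1 ≠ B2 ∧ IsDemand v q M B1 ∧ IsDemand v q M B2} = 0

/-- A joint distribution over valuation profiles is generic: each buyer's marginal is
generic. -/
def Generic {n m : ℕ} (D : Measure (Fin n → Val m)) : Prop :=
  ∀ (i : Fin n) (q : Fin m → ℝ) (M : Finset (Fin m)),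
    D {v : Fin n → Val m | ∃ B1 B2 : Finset (Fin m),
      B1 ≠ B2 ∧ IsDemand (v i) q M B1 ∧ IsDemand (v i) q M B2} = 0

/-- The empirical distribution over `k` sampled valuation profiles. -/
noncomputable def empDist {n m k : ℕ} (S : Fin k → (Fin n → Val m)) :
    Measure (Fin n → Val m) :=
  (k : ℝ≥0∞)⁻¹ • ∑ t : Fin k, Measure.dirac (S t)

/-- Prices `p` are `α`-median for the distribution `μ` (with demand sets chosen by the
rule `sel`): each item sells with probability at most `1 - α`, and each item of
positive price sells with probability at least `α`. -/
def IsMedian {n m : ℕ} (μ : Measure (Fin n → Val m))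
    (sel : Fin n → Val m → (Fin m → ℝ) → Finset (Fin m) → Finset (Fin m))
    (α : ℝ) (p : Fin m → ℝ) : Prop :=
  ∀ j : Fin m,
    μ {v : Fin n → Val m | j ∈ soldSet sel p v} ≤ ENNReal.ofReal (1 - α) ∧
    (0 < p j → ENNReal.ofReal α ≤ μ {v : Fin n → Val m | j ∈ soldSet sel p v})

/-- The sign `±1` of a Boolean. -/
def boolSign (b : Bool) : ℝ := if b then 1 else -1

lemma sum_exp_signed_sum {ι : Type*} [Fintype ι] [DecidableEq ι] (z : ι → ℝ) :
    ∑ σ : ι → Bool, Real.exp (∑ t, boolSign (σ t) * z t) = ∏ t, (2 * Real.cosh (z t)) := by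
  have h : ∀ t, 2 * Real.cosh (z t) = ∑ b : Bool, Real.exp (boolSign b * z t) := by
    intro t
    simp [boolSign, Real.cosh_eq]
    ring
  simp_rw [h, Real.exp_sum]
  rw [Finset.prod_univ_sum, Fintype.piFinset_univ]

lemma card_signed_sum_gt_le {ι : Type*} [Fintype ι] [DecidableEq ι] (z : ι → ℝ) {r a : ℝ}
    (hr : 0 < r) (hz : ∑ t, z t ^ 2 ≤ r) (ha : 0 ≤ a) :
    ((Finset.univ.filter fun σ : ι → Bool => a < ∑ t, boolSign (σ t) * z t).card : ℝ) ≤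
      2 ^ Fintype.card ι * Real.exp (-(a ^ 2 / (2 * r))) := by
  set l : ℝ := a / r with hl
  have hl0 : 0 ≤ l := by positivity
  have h1 : ∑ σ : ι → Bool, Real.exp (l * ∑ t, boolSign (σ t) * z t) ≤
      2 ^ Fintype.card ι * Real.exp (l ^ 2 * r / 2) := by
    have h2 : ∀ σ : ι → Bool, l * ∑ t, boolSign (σ t) * z t =
        ∑ t, boolSign (σ t) * (l * z t) := by
      intro σ
      rw [Finset.mul_sum]
      exact Finset.sum_congr rfl fun t _ => by ring
    simp_rw [h2]
    rw [sum_exp_signed_sum (fun t => l * z t), Finset.prod_mul_distrib, Finset.prod_const,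
      Finset.card_univ]
    refine mul_le_mul_of_nonneg_left ?_ (by positivity)
    calc ∏ t, Real.cosh (l * z t) ≤ ∏ t, Real.exp ((l * z t) ^ 2 / 2) :=
          Finset.prod_le_prod (fun t _ => (Real.cosh_pos _).le)
            (fun t _ => Real.cosh_le_exp_half_sq _)
      _ = Real.exp (l ^ 2 * (∑ t, z t ^ 2) / 2) := by
          rw [← Real.exp_sum]
          congr 1
          rw [Finset.mul_sum, Finset.sum_div]
          exact Finset.sum_congr rfl fun t _ => by ring
      _ ≤ _ := by
          apply Real.exp_le_exp.2
          have := mul_le_mul_of_nonneg_left hz (sq_nonneg l)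
          linarith
  have h3 : ((Finset.univ.filter fun σ : ι → Bool => a < ∑ t, boolSign (σ t) * z t).card : ℝ)
      * Real.exp (l * a) ≤ ∑ σ : ι → Bool, Real.exp (l * ∑ t, boolSign (σ t) * z t) := by
    rw [← nsmul_eq_mul, ← Finset.sum_const]
    refine (Finset.sum_le_sum fun σ hσ => ?_).trans
      (Finset.sum_le_univ_sum_of_nonneg fun σ => (Real.exp_pos _).le)
    have := (Finset.mem_filter.1 hσ).2
    exact Real.exp_le_exp.2 (mul_le_mul_of_nonneg_left this.le hl0)
  have h4 := h3.trans h1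
  rw [← le_div_iff₀ (Real.exp_pos _), mul_div_assoc, ← Real.exp_sub] at h4
  refine h4.trans_eq ?_
  congr 2
  rw [hl]
  field_simp
  ring

lemma card_abs_signed_sum_gt_le {ι : Type*} [Fintype ι] [DecidableEq ι] (z : ι → ℝ) {r a : ℝ}
    (hr : 0 < r) (hz : ∑ t, z t ^ 2 ≤ r) (ha : 0 ≤ a) :
    ((Finset.univ.filter fun σ : ι → Bool => a < |∑ t, boolSign (σ t) * z t|).card : ℝ) ≤
      2 ^ Fintype.card ι * (2 * Real.exp (-(a ^ 2 / (2 * r)))) := by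
  have h1 := card_signed_sum_gt_le z hr hz ha
  have h2 := card_signed_sum_gt_le (fun t => - z t) hr (by simpa using hz) ha
  have hsub : (Finset.univ.filter fun σ : ι → Bool => a < |∑ t, boolSign (σ t) * z t|) ⊆
      (Finset.univ.filter fun σ : ι → Bool => a < ∑ t, boolSign (σ t) * z t) ∪
      (Finset.univ.filter fun σ : ι → Bool => a < ∑ t, boolSign (σ t) * - z t) := by
    intro σ
    simp only [Finset.mem_filter, Finset.mem_univ, true_and, Finset.mem_union, lt_abs, mul_neg,
      Finset.sum_neg_distrib, imp_self]
  have h3 := (Finset.card_le_card hsub).trans (Finset.card_union_le _ _)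
  have h4 : ((Finset.univ.filter fun σ : ι → Bool => a < |∑ t, boolSign (σ t) * z t|).card : ℝ) ≤
      (Finset.univ.filter fun σ : ι → Bool => a < ∑ t, boolSign (σ t) * z t).card +
      (Finset.univ.filter fun σ : ι → Bool => a < ∑ t, boolSign (σ t) * - z t).card := by
    exact_mod_cast h3
  linarith

open scoped Classical in
/-- Chaining: signed sums over the last of a sequence of nets are controlled by the increments
from each net to the previous one. -/
lemma card_chaining_le {ι : Type*} [Fintype ι] [DecidableEq ι] (N : ℕ → Finset (ι → ℝ))
    (r thr : ℕ → ℝ) (hN0 : N 0 ⊆ {0}) (hr : ∀ j, 0 < r j) (hthr : ∀ j, 0 ≤ thr j)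
    (hN : ∀ j, ∀ x ∈ N (j + 1), ∃ y ∈ N j, ∑ t, (x t - y t) ^ 2 ≤ r j) (J : ℕ) :
    ((Finset.univ.filter fun σ : ι → Bool => ∃ x ∈ N J,
      ∑ j ∈ Finset.range J, thr j < |∑ t, boolSign (σ t) * x t|).card : ℝ) ≤
      2 ^ Fintype.card ι * ∑ j ∈ Finset.range J,
        (N (j + 1)).card * (2 * Real.exp (-(thr j ^ 2 / (2 * r j)))) := by
  induction J with
  | zero =>
    rw [Finset.filter_false_of_mem]
    · simp
    · rintro σ - ⟨x, hx, h⟩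
      have := Finset.mem_singleton.1 (hN0 hx)
      subst this
      simp at h
  | succ J ih =>
    choose! par hpar hdist using hN J
    have hsub : (Finset.univ.filter fun σ : ι → Bool => ∃ x ∈ N (J + 1),
        ∑ j ∈ Finset.range (J + 1), thr j < |∑ t, boolSign (σ t) * x t|) ⊆
        (Finset.univ.filter fun σ : ι → Bool => ∃ x ∈ N J,
          ∑ j ∈ Finset.range J, thr j < |∑ t, boolSign (σ t) * x t|) ∪
        (N (J + 1)).biUnion fun x => Finset.univ.filter fun σ : ι → Bool =>
          thr J < |∑ t, boolSign (σ t) * (x t - par x t)| := by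
      intro σ
      simp only [Finset.mem_filter, Finset.mem_univ, true_and, Finset.mem_union,
        Finset.mem_biUnion]
      rintro ⟨x, hx, h⟩
      by_contra hcon
      push Not at hcon
      have h1 := hcon.1 (par x) (hpar x hx)
      have h2 := hcon.2 x hx
      rw [Finset.sum_range_succ] at h
      have h3 : ∑ t, boolSign (σ t) * x t = ∑ t, boolSign (σ t) * par x t +
          ∑ t, boolSign (σ t) * (x t - par x t) := by
        rw [← Finset.sum_add_distrib]
        exact Finset.sum_congr rfl fun t _ => by ring
      rw [h3] at h
      have := abs_add_le (∑ t, boolSign (σ t) * par x t)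
        (∑ t, boolSign (σ t) * (x t - par x t))
      linarith
    have h1 : (((N (J + 1)).biUnion fun x => Finset.univ.filter fun σ : ι → Bool =>
        thr J < |∑ t, boolSign (σ t) * (x t - par x t)|).card : ℝ) ≤
        (N (J + 1)).card * (2 ^ Fintype.card ι * (2 * Real.exp (-(thr J ^ 2 / (2 * r J))))) := by
      refine (Nat.cast_le.2 Finset.card_biUnion_le).trans ?_
      rw [Nat.cast_sum, ← nsmul_eq_mul]
      exact Finset.sum_le_card_nsmul _ _ _ fun x hx =>
        card_abs_signed_sum_gt_le (fun t => x t - par x t) (hr J) (hdist x hx) (hthr J)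
    have h2 := Nat.cast_le (α := ℝ).2 ((Finset.card_le_card hsub).trans (Finset.card_union_le _ _))
    push_cast at h2
    rw [Finset.sum_range_succ (fun j => ((N (j + 1)).card : ℝ) * _), mul_add]
    have h3 := h2.trans (add_le_add_right h1 _)
    rw [mul_left_comm] at h3
    refine le_trans (le_of_eq ?_) (h3.trans (add_le_add_left (le_trans (le_of_eq ?_) ih) _))
    · congr!
    · congr!

/-- If distinct members of a family differ in many points, some short sequence of points
tells all of them apart. -/
lemma exists_separating_sequence {Z : Type*} [Fintype Z] [DecidableEq Z] [Nonempty Z]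
    (P : Finset (Finset Z)) {η : ℝ} (s : ℕ)
    (hP : ∀ T ∈ P, ∀ T' ∈ P, T ≠ T' → η * Fintype.card Z < (symmDiff T T').card)
    (hs : 2 * Real.log P.card < η * s) :
    ∃ u : Fin s → Z, Set.InjOn (fun T : Finset Z => Finset.univ.filter fun i => u i ∈ T) P := by
  classical
  rcases P.eq_empty_or_nonempty with rfl | hne
  · exact ⟨fun _ => Classical.arbitrary Z, by simp⟩
  set bad : Finset (Fin s → Z) := P.offDiag.biUnion fun q =>
    Fintype.piFinset fun _ => (symmDiff q.1 q.2)ᶜ with hbad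
  have hcardP : (0 : ℝ) < P.card := by exact_mod_cast hne.card_pos
  have hZ : (0 : ℝ) < Fintype.card Z := by exact_mod_cast Fintype.card_pos
  have hlt : (bad.card : ℝ) < Fintype.card (Fin s → Z) := by
    have h1 : (bad.card : ℝ) ≤ P.offDiag.card * (Real.exp (-(η * s)) * (Fintype.card Z) ^ s) := by
      refine (Nat.cast_le.2 Finset.card_biUnion_le).trans ?_
      rw [Nat.cast_sum, ← nsmul_eq_mul]
      refine Finset.sum_le_card_nsmul _ _ _ fun q hq => ?_
      obtain ⟨h1, h2, h3⟩ := Finset.mem_offDiag.1 hq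
      have h4 := hP _ h1 _ h2 h3
      rw [Fintype.card_piFinset_const, Nat.cast_pow]
      have h5 : (((symmDiff q.1 q.2)ᶜ).card : ℝ) ≤ Real.exp (-η) * Fintype.card Z := by
        rw [Finset.card_compl, Nat.cast_sub (Finset.card_le_univ _)]
        have := Real.add_one_le_exp (-η)
        nlinarith
      calc (((symmDiff q.1 q.2)ᶜ).card : ℝ) ^ s ≤ (Real.exp (-η) * Fintype.card Z) ^ s := by
            gcongr
        _ = _ := by
            rw [mul_pow, ← Real.exp_nat_mul]
            congr 3
            ring
    have h2 : (P.offDiag.card : ℝ) ≤ P.card * P.card := by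
      rw [Finset.offDiag_card]
      exact_mod_cast Nat.sub_le _ _
    have h3 : (P.card : ℝ) * P.card * Real.exp (-(η * s)) < 1 := by
      have : (P.card : ℝ) * P.card = Real.exp (2 * Real.log P.card) := by
        rw [two_mul, Real.exp_add, Real.exp_log hcardP]
      rw [this, ← Real.exp_add]
      rw [← Real.exp_zero]
      exact Real.exp_lt_exp.2 (by linarith)
    rw [Fintype.card_fun, Fintype.card_fin, Nat.cast_pow]
    calc (bad.card : ℝ) ≤ P.offDiag.card * (Real.exp (-(η * s)) * (Fintype.card Z) ^ s) := h1
      _ ≤ (P.card * P.card) * (Real.exp (-(η * s)) * (Fintype.card Z) ^ s) := by gcongr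
      _ = (P.card * P.card * Real.exp (-(η * s))) * (Fintype.card Z) ^ s := by ring
      _ < 1 * (Fintype.card Z) ^ s := by gcongr
      _ = _ := one_mul _
  have hlt' : bad.card < (Finset.univ : Finset (Fin s → Z)).card := by
    rw [Finset.card_univ]; exact_mod_cast hlt
  obtain ⟨u, -, hu⟩ := Finset.exists_mem_notMem_of_card_lt_card hlt'
  refine ⟨u, fun T hT T' hT' h => ?_⟩
  by_contra hne
  refine hu (Finset.mem_biUnion.2 ⟨(T, T'), Finset.mem_offDiag.2 ⟨hT, hT', hne⟩, ?_⟩)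
  refine Fintype.mem_piFinset.2 fun i => ?_
  have := Finset.ext_iff.1 h i
  simp only [Finset.mem_filter, Finset.mem_univ, true_and] at this
  simp only [Finset.mem_compl, Finset.mem_symmDiff]
  tauto

/-- Packing bound for a family of polynomial growth. -/
lemma card_packing_le {Z : Type*} [Fintype Z] [DecidableEq Z] [Nonempty Z]
    (P : Finset (Finset Z)) {η : ℝ} (hη : 0 < η) (hη1 : η ≤ 1) {K d : ℕ} (hK : 1 ≤ K)
    (hd : 1 ≤ d)
    (hP : ∀ T ∈ P, ∀ T' ∈ P, T ≠ T' → η * Fintype.card Z < (symmDiff T T').card)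
    (hgrowth : ∀ (s : ℕ) (u : Fin s → Z),
      (P.image fun T => Finset.univ.filter fun i => u i ∈ T).card ≤ (s * K + 1) ^ d) :
    (P.card : ℝ) ≤ (4 * d * K / η) ^ (2 * d) := by
  rcases P.eq_empty_or_nonempty with rfl | hne
  · simp only [Finset.card_empty, Nat.cast_zero]; positivity
  have hcardP : (1 : ℝ) ≤ P.card := by exact_mod_cast hne.card_pos
  have hlog : 0 ≤ Real.log P.card := Real.log_nonneg hcardP
  have hK' : (1 : ℝ) ≤ K := by exact_mod_cast hK
  have hd' : (1 : ℝ) ≤ d := by exact_mod_cast hd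
  set s : ℕ := ⌊2 * Real.log P.card / η⌋₊ + 1 with hs
  have hs1 : 2 * Real.log P.card < η * s := by
    have := Nat.lt_floor_add_one (2 * Real.log P.card / η)
    rw [div_lt_iff₀ hη] at this
    rw [hs]; push_cast; linarith
  have hs2 : (s : ℝ) ≤ 2 * Real.log P.card / η + 1 := by
    have := Nat.floor_le (show 0 ≤ 2 * Real.log P.card / η by positivity)
    rw [hs]; push_cast; linarith
  obtain ⟨u, hu⟩ := exists_separating_sequence P s hP hs1
  have h1 := hgrowth s u
  rw [Finset.card_image_of_injOn hu] at h1
  have h2 : (P.card : ℝ) ≤ (s * K + 1) ^ d := by exact_mod_cast h1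
  set y : ℝ := Real.log P.card / (2 * d) with hy
  have hy0 : 0 ≤ y := by positivity
  have hly : Real.log P.card = 2 * d * y := by rw [hy]; field_simp
  have hexp : (P.card : ℝ) = Real.exp y ^ d * Real.exp y ^ d := by
    rw [← pow_add, ← Real.exp_nat_mul, ← Real.exp_log (show (0:ℝ) < P.card by linarith), hly]
    congr 1; push_cast; ring
  have h3 : (s * K + 1 : ℝ) ≤ (4 * d * K / η) * Real.exp y := by
    have hη' : 1 ≤ 1 / η := by rw [le_div_iff₀ hη]; linarith
    have h4 := Real.add_one_le_exp y
    calc (s * K + 1 : ℝ) ≤ (2 * Real.log P.card / η + 1) * K + K * 1 := by nlinarith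
      _ ≤ (2 * Real.log P.card / η + 1 / η) * K + K * (1 / η) := by gcongr
      _ = (4 * d * y + 2) * (K / η) := by rw [hly]; ring
      _ ≤ (4 * d * Real.exp y) * (K / η) := by
          gcongr
          nlinarith
      _ = _ := by ring
  have h5 : Real.exp y ^ d * Real.exp y ^ d ≤ (4 * d * K / η) ^ d * Real.exp y ^ d := by
    rw [← hexp, ← mul_pow]
    exact h2.trans (by gcongr)
  have h6 : Real.exp y ^ d ≤ (4 * d * K / η) ^ d := le_of_mul_le_mul_right h5 (by positivity)
  rw [hexp, two_mul, pow_add]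
  gcongr

/-- Every finite family contains a separated subfamily that is also a net. -/
lemma exists_separated_net {Z : Type*} [Fintype Z] [DecidableEq Z] (T : Finset (Finset Z))
    {r : ℝ} (hr : 0 ≤ r) :
    ∃ P ⊆ T, (∀ A ∈ P, ∀ B ∈ P, A ≠ B → r < (symmDiff A B).card) ∧
      ∀ A ∈ T, ∃ B ∈ P, ((symmDiff A B).card : ℝ) ≤ r := by
  classical
  obtain ⟨P, hP, hmax⟩ := Finset.exists_max_image
    (T.powerset.filter fun P => ∀ A ∈ P, ∀ B ∈ P, A ≠ B → r < (symmDiff A B).card)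
    Finset.card ⟨∅, by simp⟩
  simp only [Finset.mem_filter, Finset.mem_powerset] at hP hmax
  refine ⟨P, hP.1, hP.2, fun A hA => ?_⟩
  by_contra! hcon
  have hAP : A ∉ P := fun h => by
    have := hcon A h
    simp at this
    linarith
  have := hmax (insert A P) ⟨Finset.insert_subset hA hP.1, ?_⟩
  · rw [Finset.card_insert_of_notMem hAP] at this
    omega
  · intro B hB B' hB' hne
    rcases Finset.mem_insert.1 hB with h | h <;> rcases Finset.mem_insert.1 hB' with h' | h'
    · exact absurd (h.trans h'.symm) hne
    · rw [h]; exact hcon _ h'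
    · rw [h', symmDiff_comm]; exact hcon _ h
    · exact hP.2 _ h _ h' hne

/-- The difference of the indicators of the two points of each pair. -/
noncomputable def pairDiff {ι : Type*} [DecidableEq ι] (T : Finset (ι × Bool)) (t : ι) : ℝ :=
  (if (t, true) ∈ T then 1 else 0) - (if (t, false) ∈ T then 1 else 0)

lemma sum_sq_pairDiff_sub_le {ι : Type*} [Fintype ι] [DecidableEq ι] (A B : Finset (ι × Bool)) :
    ∑ t, (pairDiff A t - pairDiff B t) ^ 2 ≤ 2 * ((symmDiff A B).card : ℝ) := by
  have h : ((symmDiff A B).card : ℝ) =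
      ∑ t : ι, ∑ b : Bool, if (t, b) ∈ symmDiff A B then (1 : ℝ) else 0 := by
    rw [← Fintype.sum_prod_type', Finset.sum_boole]
    simp
  rw [h, Finset.mul_sum]
  refine Finset.sum_le_sum fun t _ => ?_
  simp only [pairDiff, Fintype.sum_bool, Finset.mem_symmDiff]
  by_cases h1 : (t, true) ∈ A <;> by_cases h2 : (t, false) ∈ A <;>
    by_cases h3 : (t, true) ∈ B <;> by_cases h4 : (t, false) ∈ B <;> simp [h1, h2, h3, h4] <;>
    norm_num

lemma sum_sq_pairDiff_le {ι : Type*} [Fintype ι] [DecidableEq ι] (A : Finset (ι × Bool)) :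
    ∑ t, (pairDiff A t) ^ 2 ≤ (Fintype.card ι : ℝ) := by
  rw [← Finset.card_univ, ← nsmul_one, ← Finset.sum_const]
  refine Finset.sum_le_sum fun t _ => ?_
  simp only [pairDiff]
  split_ifs <;> norm_num

open scoped Classical in
/-- Tail bound, without logarithmic loss, for signed sums over a family of polynomial growth. -/
lemma card_signed_pairDiff_gt_le {ι : Type*} [Fintype ι] [DecidableEq ι] [Nonempty ι]
    (F : Finset (Finset (ι × Bool))) {K d : ℕ} (hK : 1 ≤ K) (hd : 1 ≤ d)
    (hgrowth : ∀ (s : ℕ) (u : Fin s → ι × Bool),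
      (F.image fun T => Finset.univ.filter fun i => u i ∈ T).card ≤ (s * K + 1) ^ d)
    {ε L : ℝ} (hε : 0 < ε) (hL : Real.log 4 ≤ L)
    (hk : 8192 * (2 * d * Real.log (4 * d * K) + L) ≤ Fintype.card ι * ε ^ 2) :
    ((Finset.univ.filter fun σ : ι → Bool => ∃ T ∈ F,
      Fintype.card ι * ε / 2 < |∑ t, boolSign (σ t) * pairDiff T t|).card : ℝ) ≤
      2 ^ Fintype.card ι * (4 * Real.exp (-L)) := by
  set k : ℝ := (Fintype.card ι : ℝ) with hkdef
  have hk0 : 0 < k := by rw [hkdef]; exact_mod_cast Fintype.card_pos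
  have hcardZ : (Fintype.card (ι × Bool) : ℝ) = 2 * k := by
    rw [Fintype.card_prod, Fintype.card_bool]; push_cast; ring
  have hK' : (1 : ℝ) ≤ K := by exact_mod_cast hK
  have hd' : (1 : ℝ) ≤ d := by exact_mod_cast hd
  have hnet : ∀ j : ℕ, ∃ P ⊆ F,
      (∀ A ∈ P, ∀ B ∈ P, A ≠ B → (1 / 2 : ℝ) ^ j * (2 * k) < (symmDiff A B).card) ∧
      ∀ A ∈ F, ∃ B ∈ P, ((symmDiff A B).card : ℝ) ≤ (1 / 2 : ℝ) ^ j * (2 * k) :=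
    fun j => exists_separated_net F (by positivity)
  choose M hMF hMsep hMnet using hnet
  have hMcard : ∀ j, ((M j).card : ℝ) ≤
      Real.exp ((j + 1) * (2 * d * Real.log (4 * d * K))) := by
    intro j
    have h1 := card_packing_le (M j) (η := (1 / 2 : ℝ) ^ j) (by positivity)
      (pow_le_one₀ (by norm_num) (by norm_num)) hK hd (by rw [hcardZ]; exact hMsep j)
      (fun s u => (Finset.card_le_card (Finset.image_subset_image (hMF j))).trans (hgrowth s u))
    refine h1.trans ?_
    have h2 : (4 * d * K / (1 / 2 : ℝ) ^ j) ≤ (4 * d * K) ^ (j + 1) := by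
      rw [one_div, inv_pow, div_inv_eq_mul, pow_succ']
      gcongr
      nlinarith
    have h3 : ((4 * d * K : ℝ) ^ (j + 1)) ^ (2 * d) =
        Real.exp ((j + 1) * (2 * d * Real.log (4 * d * K))) := by
      rw [← pow_mul, ← Real.exp_log (show (0 : ℝ) < 4 * d * K by positivity),
        ← Real.exp_nat_mul, Real.log_exp]
      congr 1
      push_cast
      ring
    rw [← h3]
    gcongr
  obtain ⟨J, hJ⟩ : ∃ J : ℕ, (1 / 2 : ℝ) ^ J * (2 * k) < 1 := by
    obtain ⟨J, hJ⟩ := exists_pow_lt_of_lt_one (show (0 : ℝ) < 1 / (2 * k) by positivity)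
      (show (1 / 2 : ℝ) < 1 by norm_num)
    exact ⟨J, by rwa [lt_div_iff₀ (by positivity)] at hJ⟩
  have hMJ : F ⊆ M J := by
    intro A hA
    obtain ⟨B, hB, h⟩ := hMnet J A hA
    have h1 : (symmDiff A B).card < 1 := by exact_mod_cast h.trans_lt hJ
    have h2 : symmDiff A B = ∅ := Finset.card_eq_zero.1 (by omega)
    rw [← Finset.bot_eq_empty, symmDiff_eq_bot] at h2
    rwa [h2]
  let N : ℕ → Finset (ι → ℝ) := fun j => Nat.casesOn j {0} fun i => (M i).image pairDiff
  let r : ℕ → ℝ := fun j => 8 * k * (1 / 2) ^ j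
  let thr : ℕ → ℝ := fun j => k * ε / 8 * (3 / 4) ^ j
  have hchain := card_chaining_le N r thr (le_refl _) (fun j => by positivity)
    (fun j => by positivity) ?_ (J + 1)
  · refine le_trans (Nat.cast_le.2 (Finset.card_le_card ?_)) (hchain.trans ?_)
    · intro σ
      simp only [Finset.mem_filter, Finset.mem_univ, true_and]
      rintro ⟨T, hT, h⟩
      refine ⟨pairDiff T, Finset.mem_image_of_mem _ (hMJ hT), lt_of_le_of_lt ?_ h⟩
      rw [← Finset.mul_sum, geom_sum_eq (by norm_num)]
      have : (0 : ℝ) ≤ (3 / 4) ^ (J + 1) := by positivity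
      have h2 : ((3 / 4 : ℝ) ^ (J + 1) - 1) / (3 / 4 - 1) ≤ 4 := by
        rw [div_le_iff_of_neg (by norm_num)]; linarith
      have h3 : 0 ≤ k * ε / 8 := by positivity
      nlinarith
    · gcongr
      have hq : Real.exp (-L) ≤ 1 / 4 := by
        rw [show (1 / 4 : ℝ) = Real.exp (- Real.log 4) by
          rw [Real.exp_neg, Real.exp_log (by norm_num)]; norm_num]
        exact Real.exp_le_exp.2 (by linarith)
      calc ∑ j ∈ Finset.range (J + 1),
            ((N (j + 1)).card : ℝ) * (2 * Real.exp (-(thr j ^ 2 / (2 * r j))))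
          ≤ ∑ j ∈ Finset.range (J + 1), 2 * Real.exp (-L) * (1 / 2) ^ j := by
            refine Finset.sum_le_sum fun j _ => ?_
            have hc : ((N (j + 1)).card : ℝ) ≤
                Real.exp ((j + 1) * (2 * d * Real.log (4 * d * K))) :=
              (Nat.cast_le.2 Finset.card_image_le).trans (hMcard j)
            have he : thr j ^ 2 / (2 * r j) = k * ε ^ 2 / 1024 * (9 / 8) ^ j := by
              simp only [thr, r]
              have h98 : (9 / 8 : ℝ) ^ j = ((3 / 4) ^ j) ^ 2 / (1 / 2) ^ j := by
                rw [← pow_mul, mul_comm j 2, pow_mul, ← div_pow]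
                norm_num
              rw [h98]
              generalize (3 / 4 : ℝ) ^ j = x
              have hy : (0 : ℝ) < (1 / 2) ^ j := by positivity
              generalize (1 / 2 : ℝ) ^ j = y at hy
              field_simp
              ring
            have hb : (1 + j) / 8 ≤ (9 / 8 : ℝ) ^ j := by
              have := one_add_mul_le_pow (show (-2 : ℝ) ≤ 1 / 8 by norm_num) j
              norm_num at this
              refine le_trans ?_ this
              linarith
            have hb' : (j + 1) * (2 * d * Real.log (4 * d * K) + L) ≤
                k * ε ^ 2 / 1024 * (9 / 8) ^ j := by
              calc (j + 1) * (2 * d * Real.log (4 * d * K) + L)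
                  ≤ (j + 1) * (k * ε ^ 2 / 8192) := by gcongr; linarith
                _ = k * ε ^ 2 / 1024 * ((1 + j) / 8) := by ring
                _ ≤ _ := by gcongr
            calc ((N (j + 1)).card : ℝ) * (2 * Real.exp (-(thr j ^ 2 / (2 * r j))))
                ≤ Real.exp ((j + 1) * (2 * d * Real.log (4 * d * K))) *
                  (2 * Real.exp (-((j + 1) * (2 * d * Real.log (4 * d * K) + L)))) := by
                  rw [he]; gcongr
              _ = 2 * Real.exp (-L) ^ (j + 1) := by
                  rw [← Real.exp_nat_mul, mul_left_comm, ← Real.exp_add]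
                  congr 2; push_cast; ring
              _ = 2 * Real.exp (-L) * Real.exp (-L) ^ j := by ring
              _ ≤ _ := by gcongr; linarith
        _ ≤ 4 * Real.exp (-L) := by
            rw [← Finset.mul_sum]
            have := sum_geometric_two_le (J + 1)
            have := Real.exp_pos (-L)
            nlinarith
  · rintro (_ | j) x hx
    · obtain ⟨A, -, rfl⟩ := Finset.mem_image.1 hx
      refine ⟨0, Finset.mem_singleton_self _, ?_⟩
      have := sum_sq_pairDiff_le A
      simp only [Pi.zero_apply, sub_zero, r, pow_zero]
      linarith
    · obtain ⟨A, hA, rfl⟩ := Finset.mem_image.1 hx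
      obtain ⟨B, hB, h⟩ := hMnet j A (hMF _ hA)
      refine ⟨pairDiff B, Finset.mem_image_of_mem _ hB, (sum_sq_pairDiff_sub_le A B).trans ?_⟩
      simp only [r, pow_succ]
      linarith

/-- The indicator function of a set, with real values. -/
noncomputable def ind {Ω : Type*} (A : Set Ω) (x : Ω) : ℝ := A.indicator (fun _ => 1) x

lemma measurable_ind {Ω : Type*} [MeasurableSpace Ω] {A : Set Ω} (hA : MeasurableSet A) :
    Measurable (ind A) :=
  measurable_const.indicator hA

lemma ind_mem_Icc {Ω : Type*} (A : Set Ω) (x : Ω) : ind A x ∈ Set.Icc (0 : ℝ) 1 := by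
  unfold ind
  by_cases h : x ∈ A <;> simp [h]

lemma measure_pi_sum_ind_deviation_le {Ω : Type*} [MeasurableSpace Ω] (D : Measure Ω)
    [IsProbabilityMeasure D] {A : Set Ω} (hA : MeasurableSet A) {k : ℕ} {ε : ℝ} (hε : 0 < ε)
    (hk : 2 ≤ k * ε ^ 2) :
    (Measure.pi fun _ : Fin k => D)
      {S | k * ε / 2 ≤ |∑ t, ind A (S t) - k * D.real A|} ≤ 1 / 2 := by
  have hk0 : (0 : ℝ) < k := by
    by_contra h
    have : (k : ℝ) = 0 := le_antisymm (not_lt.1 h) (Nat.cast_nonneg k)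
    rw [this] at hk
    linarith
  have hL : MemLp (ind A) 2 D :=
    MemLp.of_bound (measurable_ind hA).aestronglyMeasurable 1 (Filter.Eventually.of_forall
      fun x => by
        have := ind_mem_Icc A x
        rw [Real.norm_eq_abs, abs_le]
        exact ⟨by linarith [this.1], this.2⟩)
  set X : (Fin k → Ω) → ℝ := ∑ t, fun S : Fin k → Ω => ind A (S t) with hX
  have hXapp : ∀ S, X S = ∑ t, ind A (S t) := fun S => by rw [hX, Finset.sum_apply]
  have hLt : ∀ t : Fin k, MemLp (fun S : Fin k → Ω => ind A (S t)) 2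
      (Measure.pi fun _ : Fin k => D) := fun t =>
    hL.comp_measurePreserving (measurePreserving_eval (fun _ : Fin k => D) t)
  have hXL : MemLp X 2 (Measure.pi fun _ : Fin k => D) := memLp_finsetSum' _ fun t _ => hLt t
  have hvar : ProbabilityTheory.variance X (Measure.pi fun _ : Fin k => D) ≤ k / 4 := by
    rw [hX, ProbabilityTheory.variance_sum_pi (X := fun _ : Fin k => ind A) fun _ => hL]
    have := ProbabilityTheory.variance_le_sq_of_bounded (μ := D) (X := ind A) (a := 0) (b := 1)
      (Filter.Eventually.of_forall (ind_mem_Icc A)) (measurable_ind hA).aemeasurable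
    simp only [Finset.sum_const, Finset.card_univ, Fintype.card_fin, nsmul_eq_mul]
    nlinarith
  have hmean : ∫ S, X S ∂(Measure.pi fun _ : Fin k => D) = k * D.real A := by
    simp_rw [hXapp]
    rw [integral_finsetSum _ fun t _ => (hLt t).integrable (by norm_num)]
    have : ∀ t : Fin k, ∫ S : Fin k → Ω, ind A (S t) ∂(Measure.pi fun _ : Fin k => D) =
        D.real A := by
      intro t
      rw [integral_comp_eval (μ := fun _ : Fin k => D) (f := ind A)
        (measurable_ind hA).aestronglyMeasurable]
      exact (integral_indicator_const (1 : ℝ) hA).trans (by simp)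
    simp [this]
  have hcheb := ProbabilityTheory.meas_ge_le_variance_div_sq hXL
    (show 0 < k * ε / 2 by positivity)
  simp_rw [hmean, hXapp] at hcheb
  refine hcheb.trans ?_
  rw [show (1 / 2 : ℝ≥0∞) = ENNReal.ofReal (1 / 2) by
    rw [ENNReal.ofReal_div_of_pos (by norm_num)]; simp]
  refine ENNReal.ofReal_le_ofReal ?_
  rw [div_le_iff₀ (by positivity)]
  nlinarith

/-- Swap the two points of each pair where `σ` is false. -/
def swapAt {ι Ω : Type*} (σ : ι → Bool) (z : ι → Ω × Ω) (t : ι) : Ω × Ω :=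
  if σ t then z t else (z t).swap

lemma measurePreserving_swapAt {ι Ω : Type*} [Fintype ι] [MeasurableSpace Ω] (D : Measure Ω)
    [IsProbabilityMeasure D] (σ : ι → Bool) :
    MeasurePreserving (swapAt σ) (Measure.pi fun _ : ι => D.prod D)
      (Measure.pi fun _ : ι => D.prod D) := by
  refine measurePreserving_pi (f := fun t (w : Ω × Ω) => if σ t then w else w.swap) _ _ fun t => ?_
  cases σ t
  · simpa using Measure.measurePreserving_swap (μ := D) (ν := D)
  · simp only [if_true]
    exact MeasurePreserving.id (D.prod D)

open scoped Classical in
lemma measure_pi_prod_le_of_card_swapAt_le {ι Ω : Type*} [Fintype ι] [DecidableEq ι]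
    [MeasurableSpace Ω]
    (D : Measure Ω) [IsProbabilityMeasure D] {E : Set (ι → Ω × Ω)} (hE : MeasurableSet E) {c : ℝ}
    (h : ∀ z, ((Finset.univ.filter fun σ : ι → Bool => swapAt σ z ∈ E).card : ℝ) ≤
      2 ^ Fintype.card ι * c) :
    (Measure.pi fun _ : ι => D.prod D) E ≤ ENNReal.ofReal c := by
  set μ := (Measure.pi fun _ : ι => D.prod D) with hμ
  have h1 : ∀ σ : ι → Bool, μ E = ∫⁻ z, E.indicator 1 (swapAt σ z) ∂μ := by
    intro σ
    rw [(measurePreserving_swapAt D σ).lintegral_comp (measurable_one.indicator hE),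
      lintegral_indicator_one hE]
  have h2 : (2 : ℝ≥0∞) ^ Fintype.card ι * μ E ≤ 2 ^ Fintype.card ι * ENNReal.ofReal c := by
    calc (2 : ℝ≥0∞) ^ Fintype.card ι * μ E = ∑ σ : ι → Bool, μ E := by
          simp
      _ = ∑ σ : ι → Bool, ∫⁻ z, E.indicator 1 (swapAt σ z) ∂μ :=
          Finset.sum_congr rfl fun σ _ => h1 σ
      _ = ∫⁻ z, ∑ σ : ι → Bool, E.indicator 1 (swapAt σ z) ∂μ := by
          symm
          exact lintegral_finsetSum _ fun σ _ => (measurable_one.indicator hE).comp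
            (measurePreserving_swapAt D σ).measurable
      _ ≤ ∫⁻ _, ENNReal.ofReal (2 ^ Fintype.card ι * c) ∂μ := by
          refine lintegral_mono fun z => ?_
          have : ∑ σ : ι → Bool, E.indicator (1 : (ι → Ω × Ω) → ℝ≥0∞) (swapAt σ z) =
              ENNReal.ofReal ((Finset.univ.filter fun σ : ι → Bool => swapAt σ z ∈ E).card) := by
            rw [ENNReal.ofReal_natCast, Finset.card_filter]
            push_cast
            exact Finset.sum_congr rfl fun σ _ => by simp [Set.indicator_apply]
          rw [this]
          exact ENNReal.ofReal_le_ofReal (h z)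
      _ = 2 ^ Fintype.card ι * ENNReal.ofReal c := by
          rw [lintegral_const, hμ, measure_univ, mul_one, ENNReal.ofReal_mul (by positivity),
            ENNReal.ofReal_pow (by norm_num)]
          simp
  exact (ENNReal.mul_le_mul_iff_right (by simp) (by simp)).1 h2

/-- Symmetrization: deviations from the mean are controlled by differences of two samples. -/
lemma measure_deviation_le_two_mul {Ω Θ : Type*} [MeasurableSpace Ω] (D : Measure Ω)
    [IsProbabilityMeasure D] {A : Θ → Set Ω} (hA : ∀ θ, MeasurableSet (A θ)) {k : ℕ} {ε : ℝ}
    (hε : 0 < ε) (hk : 2 ≤ k * ε ^ 2)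
    (hE : MeasurableSet {z : Fin k → Ω × Ω | ∃ θ,
      k * ε / 2 < |∑ t, (ind (A θ) (z t).1 - ind (A θ) (z t).2)|}) :
    (Measure.pi fun _ : Fin k => D)
      {S | ∃ θ, k * ε < |∑ t, ind (A θ) (S t) - k * D.real (A θ)|} ≤
    2 * (Measure.pi fun _ : Fin k => D.prod D) {z : Fin k → Ω × Ω | ∃ θ,
      k * ε / 2 < |∑ t, (ind (A θ) (z t).1 - ind (A θ) (z t).2)|} := by
  set P := (Measure.pi fun _ : Fin k => D) with hP
  set E := {z : Fin k → Ω × Ω | ∃ θ,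
      k * ε / 2 < |∑ t, (ind (A θ) (z t).1 - ind (A θ) (z t).2)|} with hEdef
  have hmp := measurePreserving_arrowProdEquivProdArrow Ω Ω (Fin k) (fun _ => D) (fun _ => D)
  set e := MeasurableEquiv.arrowProdEquivProdArrow Ω Ω (Fin k) with he
  have hE' : MeasurableSet (e.symm ⁻¹' E) := e.symm.measurable hE
  have h1 : (Measure.pi fun _ : Fin k => D.prod D) E = (P.prod P) (e.symm ⁻¹' E) := by
    rw [← hmp.measure_preimage hE'.nullMeasurableSet, ← Set.preimage_comp]
    congr 1
  have hmark := mul_meas_ge_le_lintegral (μ := P) (measurable_measure_prodMk_left (ν := P) hE')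
    (1 / 2)
  rw [← Measure.prod_apply hE', ← h1] at hmark
  have hsub : {S | ∃ θ, k * ε < |∑ t, ind (A θ) (S t) - k * D.real (A θ)|} ⊆
      {S | 1 / 2 ≤ P (Prod.mk S ⁻¹' (e.symm ⁻¹' E))} := by
    rintro S ⟨θ, hθ⟩
    have hch := measure_pi_sum_ind_deviation_le D (hA θ) hε hk
    rw [← hP] at hch
    set G := {S' : Fin k → Ω | k * ε / 2 ≤ |∑ t, ind (A θ) (S' t) - k * D.real (A θ)|} with hG
    have hcompl : Gᶜ ⊆ Prod.mk S ⁻¹' (e.symm ⁻¹' E) := by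
      intro S' hS'
      rw [hG, Set.mem_compl_iff, Set.mem_ofPred_eq, not_le] at hS'
      change ∃ θ, k * ε / 2 < |∑ t, (ind (A θ) (S t) - ind (A θ) (S' t))|
      refine ⟨θ, ?_⟩
      rw [Finset.sum_sub_distrib]
      have := abs_sub_abs_le_abs_sub (∑ t, ind (A θ) (S t) - k * D.real (A θ))
        (∑ t, ind (A θ) (S' t) - k * D.real (A θ))
      rw [sub_sub_sub_cancel_right] at this
      linarith
    have hone : (1 : ℝ≥0∞) ≤ P G + P Gᶜ := by
      rw [← measure_univ (μ := P), ← Set.union_compl_self G]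
      exact measure_union_le _ _
    have hhalf : (1 / 2 : ℝ≥0∞) ≤ P Gᶜ := by
      by_contra hlt
      rw [not_le] at hlt
      have := ENNReal.add_lt_add_of_le_of_lt (by
        exact ne_top_of_le_ne_top (by simp) hch) hch hlt
      rw [ENNReal.add_halves] at this
      exact absurd hone (not_le.2 this)
    exact hhalf.trans (measure_mono hcompl)
  calc P _ ≤ P {S | 1 / 2 ≤ P (Prod.mk S ⁻¹' (e.symm ⁻¹' E))} := measure_mono hsub
    _ = 2 * (1 / 2 * P {S | 1 / 2 ≤ P (Prod.mk S ⁻¹' (e.symm ⁻¹' E))}) := by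
        rw [← mul_assoc, one_div, ENNReal.mul_inv_cancel (by simp) (by simp), one_mul]
    _ ≤ _ := by gcongr

open scoped Classical in
/-- Uniform convergence, without logarithmic loss, for families of polynomial growth. -/
theorem measure_uniform_deviation_le {Ω Θ : Type*} [MeasurableSpace Ω] (D : Measure Ω)
    [IsProbabilityMeasure D] {A : Θ → Set Ω} (hA : ∀ θ, MeasurableSet (A θ)) {K d : ℕ}
    (hK : 1 ≤ K) (hd : 1 ≤ d)
    (hgrowth : ∀ (s : ℕ) (u : Fin s → Ω),
      (Set.range fun θ => Finset.univ.filter fun i => u i ∈ A θ).ncard ≤ (s * K + 1) ^ d)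
    {k : ℕ} {ε L : ℝ} (hε : 0 < ε) (hL : Real.log 4 ≤ L)
    (hk : 8192 * (2 * d * Real.log (4 * d * K) + L) ≤ k * ε ^ 2)
    (hE : MeasurableSet {z : Fin k → Ω × Ω | ∃ θ,
      k * ε / 2 < |∑ t, (ind (A θ) (z t).1 - ind (A θ) (z t).2)|}) :
    (Measure.pi fun _ : Fin k => D)
      {S | ∃ θ, k * ε < |∑ t, ind (A θ) (S t) - k * D.real (A θ)|} ≤
      ENNReal.ofReal (8 * Real.exp (-L)) := by
  have hK' : (1 : ℝ) ≤ K := by exact_mod_cast hK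
  have hd' : (1 : ℝ) ≤ d := by exact_mod_cast hd
  have hlog4 : 1 ≤ Real.log 4 := by
    rw [show (4 : ℝ) = 2 ^ 2 by norm_num, Real.log_pow]
    have := Real.log_two_gt_d9
    push_cast
    linarith
  have hlogK : 0 ≤ Real.log (4 * d * K) := Real.log_nonneg (by nlinarith)
  have hk2 : 2 ≤ k * ε ^ 2 := by
    have : 0 ≤ 2 * d * Real.log (4 * d * K) := by positivity
    linarith
  have hk0 : 0 < k := by
    rcases Nat.eq_zero_or_pos k with rfl | h
    · norm_num at hk2
    · exact h
  have : Nonempty (Fin k) := ⟨⟨0, hk0⟩⟩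
  refine (measure_deviation_le_two_mul D hA hε hk2 hE).trans ?_
  have h := measure_pi_prod_le_of_card_swapAt_le D hE (c := 4 * Real.exp (-L)) ?_
  · refine (mul_le_mul_right h 2).trans_eq ?_
    rw [show (8 : ℝ) * Real.exp (-L) = 2 * (4 * Real.exp (-L)) by ring,
      ENNReal.ofReal_mul (p := 2) (by norm_num)]
    simp
  intro z
  let w : Fin k × Bool → Ω := fun q => if q.2 then (z q.1).1 else (z q.1).2
  let tr : Θ → Finset (Fin k × Bool) := fun θ => Finset.univ.filter fun q => w q ∈ A θ
  let F : Finset (Finset (Fin k × Bool)) := (Set.toFinite (Set.range tr)).toFinset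
  refine le_trans (Nat.cast_le.2 (Finset.card_le_card ?_))
    ((card_signed_pairDiff_gt_le F hK hd ?_ hε hL (by simpa using hk)).trans_eq (by simp))
  · intro σ
    simp only [Finset.mem_filter, Finset.mem_univ, true_and, Set.mem_ofPred_eq]
    rintro ⟨θ, hθ⟩
    refine ⟨tr θ, by simp [F], ?_⟩
    rw [Fintype.card_fin]
    refine hθ.trans_eq ?_
    congr 1
    refine Finset.sum_congr rfl fun t _ => ?_
    unfold swapAt boolSign pairDiff ind
    cases σ t <;> simp [tr, w, Set.indicator_apply]
  · intro s u
    refine le_trans (le_of_eq ?_) (hgrowth s fun i => w (u i))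
    rw [← Set.ncard_coe_finset]
    congr 1
    ext T
    simp [F, tr]

lemma sum_choose_le_pow (N d : ℕ) : ∑ i ∈ Finset.Iic d, N.choose i ≤ (N + 1) ^ d := by
  rw [add_pow, ← Nat.range_succ_eq_Iic]
  refine Finset.sum_le_sum fun i hi => ?_
  have hi' : i ≤ d := Nat.lt_succ_iff.1 (Finset.mem_range.1 hi)
  calc N.choose i ≤ N ^ i := Nat.choose_le_pow _ _
    _ = N ^ i * 1 ^ (d - i) * 1 := by simp
    _ ≤ _ := Nat.mul_le_mul_left _ (Nat.choose_pos hi')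

open scoped Classical in
/-- The number of sign patterns of finitely many affine functions on `ℝ^m`. -/
lemma ncard_affine_sign_patterns_le {I : Type*} [Fintype I] {m : ℕ} (a : I → Fin m → ℝ)
    (b : I → ℝ) :
    (Set.range fun p : Fin m → ℝ =>
      Finset.univ.filter fun i => 0 ≤ ∑ j, a i j * p j + b i).ncard ≤
      (Fintype.card I + 1) ^ (m + 1) := by
  set R := Set.range fun p : Fin m → ℝ =>
      Finset.univ.filter fun i => 0 ≤ ∑ j, a i j * p j + b i with hR
  set F : Finset (Finset I) := (Set.toFinite R).toFinset with hF
  rw [Set.ncard_eq_toFinset_card R]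
  refine (Finset.card_le_card_shatterer F).trans (Finset.card_shatterer_le_sum_vcDim.trans ?_)
  refine le_trans ?_ (sum_choose_le_pow _ _)
  refine Finset.sum_le_sum_of_subset (Finset.Iic_subset_Iic.2 ?_)
  refine Finset.sup_le fun s hs => ?_
  rw [Finset.mem_shatterer] at hs
  by_contra! hcard
  let w : s → Option (Fin m) → ℝ := fun i o => o.elim (b i) (a i)
  have hdep : ¬ LinearIndependent ℝ w := by
    intro hli
    have := hli.fintype_card_le_finrank
    simp at this
    omega
  rw [Fintype.linearIndependent_iff] at hdep
  push Not at hdep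
  obtain ⟨g, hg, i₀, hi₀⟩ := hdep
  obtain ⟨c, hc, i₁, hi₁⟩ : ∃ c : s → ℝ, ∑ i, c i • w i = 0 ∧ ∃ i, c i < 0 := by
    rcases lt_or_gt_of_ne hi₀ with h | h
    · exact ⟨g, hg, i₀, h⟩
    · exact ⟨-g, by simp only [Pi.neg_apply, neg_smul, Finset.sum_neg_distrib, hg, neg_zero], i₀, by simpa using h⟩
  obtain ⟨t, ht, hst⟩ := hs (t := (Finset.univ.filter fun i : s => 0 ≤ c i).map
    (Function.Embedding.subtype _)) (by
      intro x hx
      obtain ⟨y, -, rfl⟩ := Finset.mem_map.1 hx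
      exact y.2)
  obtain ⟨p, rfl⟩ : t ∈ R := by simpa [hF] using ht
  have hsign : ∀ i : s, 0 ≤ ∑ j, a i j * p j + b i ↔ 0 ≤ c i := by
    intro i
    have := Finset.ext_iff.1 hst i
    simpa using this
  have hzero : ∑ i : s, c i * (∑ j, a i j * p j + b i) = 0 := by
    have h1 : ∀ o, ∑ i : s, c i * w i o = 0 := by
      intro o
      have := congrFun hc o
      simpa [Finset.sum_apply] using this
    have h2 : ∑ i : s, c i * b i = 0 := h1 none
    have h3 : ∀ j, ∑ i : s, c i * a i j = 0 := fun j => h1 (some j)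
    simp_rw [mul_add, Finset.sum_add_distrib, h2, Finset.mul_sum]
    rw [Finset.sum_comm]
    simp_rw [← mul_assoc, ← Finset.sum_mul, h3]
    simp
  have hnonneg : ∀ i : s, 0 ≤ c i * (∑ j, a i j * p j + b i) := by
    intro i
    rcases le_or_gt 0 (c i) with h | h
    · exact mul_nonneg h ((hsign i).2 h)
    · have := mt (hsign i).1 (not_le.2 h)
      exact (mul_pos_of_neg_of_neg h (not_le.1 this)).le
  have hpos : 0 < c i₁ * (∑ j, a i₁ j * p j + b i₁) :=
    mul_pos_of_neg_of_neg hi₁ (not_le.1 (mt (hsign i₁).1 (not_le.2 hi₁)))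
  have := Finset.sum_pos' (fun i _ => hnonneg i) ⟨i₁, Finset.mem_univ _, hpos⟩
  linarith

section Cubical

variable {T ι : Type*} [AddCommGroup T]

/-- A `1`-cochain is closed when it is path independent on squares. -/
def IsClosedCochain (e : ι → T) (a : T → ι → ZMod 2) : Prop :=
  ∀ x d d', a x d + a (x + e d) d' = a x d' + a (x + e d') d

/-- The `1`-cochain `δ f`. -/
def diffCochain (e : ι → T) (f : T → ZMod 2) (x : T) (d : ι) : ZMod 2 := f (x + e d) + f x

theorem isClosedCochain_diffCochain_add (e : ι → T) (f : T → ZMod 2) {c : T → ι → ZMod 2}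
    (hc : IsClosedCochain e c) : IsClosedCochain e (fun x d => diffCochain e f x d + c x d) := by
  intro x d d'
  have h := hc x d d'
  have h1 := CharTwo.add_self_eq_zero (f (x + e d))
  have h2 := CharTwo.add_self_eq_zero (f (x + e d'))
  simp only [diffCochain]
  rw [add_right_comm x (e d') (e d)]
  linear_combination h + h1 - h2

variable [DecidableEq ι]

/-- The coboundary of a mod 2 cubical cochain; `φ x S` is the value on the cube with base point
`x` spanned by the directions `e d`, `d ∈ S`. -/
def coboundary (e : ι → T) (φ : T → Finset ι → ZMod 2) (x : T) (S : Finset ι) : ZMod 2 :=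
  ∑ d ∈ S, (φ (x + e d) (S.erase d) + φ x (S.erase d))

/-- The cup product of a mod 2 cubical `1`-cochain with a cochain. -/
def cupLeft (e : ι → T) (a : T → ι → ZMod 2) (φ : T → Finset ι → ZMod 2) (x : T)
    (S : Finset ι) : ZMod 2 :=
  ∑ d ∈ S, a x d * φ (x + e d) (S.erase d)

/-- The iterated cup product of a list of `1`-cochains. -/
def cupList (e : ι → T) : List (T → ι → ZMod 2) → T → Finset ι → ZMod 2
  | [] => fun _ S => if S = ∅ then 1 else 0
  | a :: l => cupLeft e a (cupList e l)

/-- A sum of a symmetric function over ordered pairs of distinct elements vanishes mod 2. -/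
theorem sum_sum_erase_eq_zero (S : Finset ι) (h : ι → ι → ZMod 2) (hh : ∀ d d', h d d' = h d' d) :
    ∑ d ∈ S, ∑ d' ∈ S.erase d, h d d' = 0 := by
  rw [Finset.sum_sigma']
  refine Finset.sum_involution (fun p _ => ⟨p.2, p.1⟩) ?_ ?_ ?_ ?_
  · rintro ⟨d, d'⟩ -
    simp only
    rw [hh d' d]
    exact CharTwo.add_self_eq_zero _
  · rintro ⟨d, d'⟩ hp - heq
    simp only [Finset.mem_sigma, Finset.mem_erase] at hp
    simp only [Sigma.mk.injEq] at heq
    exact hp.2.1 heq.1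
  · rintro ⟨d, d'⟩ hp
    simp only [Finset.mem_sigma, Finset.mem_erase] at hp ⊢
    exact ⟨hp.2.2, Ne.symm hp.2.1, hp.1⟩
  · rintro ⟨d, d'⟩ -
    rfl

theorem sum_sum_erase_comm (S : Finset ι) (h : ι → ι → ZMod 2) :
    ∑ d ∈ S, ∑ d' ∈ S.erase d, h d d' = ∑ d ∈ S, ∑ d' ∈ S.erase d, h d' d := by
  refine Finset.sum_comm' ?_
  intro x y
  simp only [Finset.mem_erase]
  tauto

/-- Leibniz rule for the cup product with a closed `1`-cochain. -/
theorem coboundary_cupLeft (e : ι → T) {a : T → ι → ZMod 2} (ha : IsClosedCochain e a)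
    (φ : T → Finset ι → ZMod 2) :
    coboundary e (cupLeft e a φ) = cupLeft e a (coboundary e φ) := by
  funext x S
  rw [← sub_eq_zero, CharTwo.sub_eq_add]
  simp only [coboundary, cupLeft, Finset.mul_sum, ← Finset.sum_add_distrib, mul_add]
  simp only [Finset.sum_add_distrib]
  rw [sum_sum_erase_comm S fun d d' => a x d' * φ (x + e d') ((S.erase d).erase d')]
  have hswap : ∀ d d', (S.erase d').erase d = (S.erase d).erase d' := fun d d' =>
    Finset.erase_right_comm
  simp only [hswap]
  set X := ∑ d ∈ S, ∑ d' ∈ S.erase d, a x d * φ (x + e d) ((S.erase d).erase d')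
  have hz := sum_sum_erase_eq_zero S
    (fun d d' => (a x d + a (x + e d) d') * φ (x + e d + e d') ((S.erase d).erase d'))
    (fun d d' => by
      rw [ha x d d', hswap d' d, add_right_comm x (e d)])
  simp only [add_mul, Finset.sum_add_distrib] at hz
  have hX : X + X = 0 := CharTwo.add_self_eq_zero _
  linear_combination hz + hX

theorem coboundary_cupList (e : ι → T) (l : List (T → ι → ZMod 2))
    (hl : ∀ a ∈ l, IsClosedCochain e a) : coboundary e (cupList e l) = 0 := by
  induction l with
  | nil =>
    funext x S
    simp [coboundary, cupList, CharTwo.add_self_eq_zero]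
  | cons a l ih =>
    rw [cupList, coboundary_cupLeft e (hl a (by simp)), ih fun b hb => hl b (by simp [hb])]
    funext x S
    simp [cupLeft]

/-- Changing closed `1`-cochains by exact ones changes the iterated cup product by a
coboundary. -/
theorem exists_cupList_eq_add_coboundary {J : Type*} (e : ι → T) (f : J → T → ZMod 2)
    (c : J → T → ι → ZMod 2) (hc : ∀ j, IsClosedCochain e (c j)) (l : List J) :
    ∃ ψ, ∀ x S, cupList e (l.map fun j x d => diffCochain e (f j) x d + c j x d) x S =
      cupList e (l.map c) x S + coboundary e ψ x S := by
  induction l with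
  | nil => exact ⟨0, fun x S => by simp [coboundary]⟩
  | cons j l ih =>
    obtain ⟨ψ, hψ⟩ := ih
    set F := cupList e (l.map fun j x d => diffCochain e (f j) x d + c j x d) with hF
    have hclosed : coboundary e F = 0 := coboundary_cupList e _ (by
      intro a ha
      obtain ⟨i, -, rfl⟩ := List.mem_map.1 ha
      exact isClosedCochain_diffCochain_add e (f i) (hc i))
    refine ⟨fun x S => f j x * F x S + cupLeft e (c j) ψ x S, fun x S => ?_⟩
    have h1 : coboundary e (cupLeft e (c j) ψ) x S = cupLeft e (c j) (coboundary e ψ) x S := by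
      rw [coboundary_cupLeft e (hc j)]
    have h2 : coboundary e F x S = 0 := by rw [hclosed]; rfl
    have h3 : cupLeft e (c j) F x S =
        cupLeft e (c j) (cupList e (l.map c)) x S + cupLeft e (c j) (coboundary e ψ) x S := by
      simp only [cupLeft, hψ, mul_add, Finset.sum_add_distrib]
    have h4 : coboundary e (fun x S => f j x * F x S + cupLeft e (c j) ψ x S) x S =
        cupLeft e (diffCochain e (f j)) F x S + f j x * coboundary e F x S +
          coboundary e (cupLeft e (c j) ψ) x S := by
      generalize cupLeft e (c j) ψ = G
      simp only [coboundary, cupLeft, diffCochain, Finset.mul_sum, ← Finset.sum_add_distrib]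
      refine Finset.sum_congr rfl fun d _ => ?_
      have := CharTwo.add_self_eq_zero (f j x * F (x + e d) (S.erase d))
      linear_combination -this
    have h5 : cupLeft e (fun x d => diffCochain e (f j) x d + c j x d) F x S =
        cupLeft e (diffCochain e (f j)) F x S + cupLeft e (c j) F x S := by
      simp only [cupLeft, add_mul, Finset.sum_add_distrib]
    simp only [List.map_cons, cupList]
    rw [h4, h2, h1, h5, h3]
    ring

theorem sum_coboundary [Fintype T] (e : ι → T) (ψ : T → Finset ι → ZMod 2) (S : Finset ι) :
    ∑ x, coboundary e ψ x S = 0 := by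
  simp only [coboundary]
  rw [Finset.sum_comm]
  refine Finset.sum_eq_zero fun d _ => ?_
  have h := Equiv.sum_comp (Equiv.addRight (e d)) fun x => ψ x (S.erase d)
  simp only [Equiv.coe_addRight] at h
  rw [Finset.sum_add_distrib, h]
  exact CharTwo.add_self_eq_zero _

/-- A nonvanishing iterated cup product has a nonvanishing monotone path. -/
theorem exists_ne_zero_of_cupList_ne_zero (e : ι → T) (l : List (T → ι → ZMod 2)) (x : T)
    (S : Finset ι) (h : cupList e l x S ≠ 0) :
    ∀ a ∈ l, ∃ U ⊆ S, ∃ d ∈ S, d ∉ U ∧ a (x + ∑ i ∈ U, e i) d ≠ 0 := by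
  induction l generalizing x S with
  | nil => simp
  | cons b l ih =>
    simp only [cupList, cupLeft] at h
    obtain ⟨d, hd, hne⟩ := Finset.exists_ne_zero_of_sum_ne_zero h
    intro a ha
    rcases List.mem_cons.1 ha with rfl | ha
    · exact ⟨∅, by simp, d, hd, by simp, by simpa using left_ne_zero_of_mul hne⟩
    · obtain ⟨U, hU, d', hd', hd'U, hane⟩ := ih _ _ (right_ne_zero_of_mul hne) a ha
      have hdU : d ∉ U := fun hm => by simpa using hU hm
      refine ⟨insert d U, ?_, d', Finset.mem_of_mem_erase hd', ?_, ?_⟩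
      · intro i hi
        rcases Finset.mem_insert.1 hi with rfl | hi
        · exact hd
        · exact Finset.mem_of_mem_erase (hU hi)
      · rw [Finset.mem_insert, not_or]
        exact ⟨Finset.ne_of_mem_erase hd', hd'U⟩
      · rwa [Finset.sum_insert hdU, ← add_assoc]

end Cubical

/-- The `1`-cochain counting the wraps around the torus in direction `j`. -/
def wrapCochain {m N : ℕ} (j : Fin m) (x : Fin m → ZMod N) (d : Fin m) : ZMod 2 :=
  if d = j ∧ x j = -1 then 1 else 0

theorem isClosedCochain_wrapCochain {m N : ℕ} (j : Fin m) :
    IsClosedCochain (fun d : Fin m => Pi.single d (1 : ZMod N)) (wrapCochain j) := by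
  intro x d d'
  by_cases hdd : d = d'
  · subst hdd; rfl
  by_cases h1 : d = j
  · subst h1
    have h2 : ¬ d' = d := fun h => hdd h.symm
    simp [wrapCochain, h2, hdd]
  · by_cases h2 : d' = j
    · subst h2
      simp [wrapCochain, h1]
    · simp [wrapCochain, h1, h2]

theorem cupList_wrapCochain {m N : ℕ} (l : List (Fin m)) (hl : l.Nodup) (x : Fin m → ZMod N) :
    cupList (fun d : Fin m => Pi.single d (1 : ZMod N)) (l.map wrapCochain) x l.toFinset =
      if ∀ j ∈ l, x j = -1 then 1 else 0 := by
  induction l generalizing x with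
  | nil => simp [cupList]
  | cons j l ih =>
    rw [List.nodup_cons] at hl
    simp only [List.map_cons, cupList, cupLeft]
    rw [Finset.sum_eq_single j]
    · have herase : (j :: l).toFinset.erase j = l.toFinset := by
        rw [List.toFinset_cons, Finset.erase_insert (by simpa using hl.1)]
      rw [herase, ih hl.2]
      have hne : ∀ i ∈ l, (x + Pi.single j (1 : ZMod N) : Fin m → ZMod N) i = x i := by
        intro i hi
        have : i ≠ j := fun h => hl.1 (h ▸ hi)
        simp [this]
      have hiff : (∀ i ∈ l, (x + Pi.single j (1 : ZMod N) : Fin m → ZMod N) i = -1) ↔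
          ∀ i ∈ l, x i = -1 := forall₂_congr fun i hi => by rw [hne i hi]
      simp only [hiff, wrapCochain, true_and, List.forall_mem_cons, ite_and]
      split_ifs <;> simp
    · intro d _ hd
      simp [wrapCochain, hd]
    · simp

/-- A cubical form of Kuhn's lemma: `m` binary labellings of a grid, the `j`-th one separating
the two facets orthogonal to the `j`-th direction, are all non-constant on a common small cube. -/
theorem exists_cube_nonconstant {m M : ℕ} (f : Fin m → (Fin m → ZMod (M + 1)) → ZMod 2)
    (hf0 : ∀ j x, x j = 0 → f j x = 0) (hf1 : ∀ j x, x j = -1 → f j x = 1) :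
    ∃ x : Fin m → ZMod (M + 1), (∀ j, x j ≠ -1) ∧ ∀ j, ∃ U V : Finset (Fin m),
      f j (x + ∑ i ∈ U, Pi.single i 1) ≠ f j (x + ∑ i ∈ V, Pi.single i 1) := by
  classical
  set e : Fin m → Fin m → ZMod (M + 1) := fun d => Pi.single d 1 with he
  obtain ⟨ψ, hψ⟩ := exists_cupList_eq_add_coboundary e f wrapCochain
    isClosedCochain_wrapCochain (List.finRange m)
  have huniv : (List.finRange m).toFinset = Finset.univ := by
    ext; simp
  have hsum : ∑ x, cupList e ((List.finRange m).map fun j x d =>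
      diffCochain e (f j) x d + wrapCochain j x d) x Finset.univ = 1 := by
    simp only [hψ, Finset.sum_add_distrib, sum_coboundary, add_zero]
    rw [← huniv]
    simp only [he, cupList_wrapCochain _ (List.nodup_finRange m)]
    rw [Finset.sum_eq_single (fun _ => -1)]
    · simp
    · intro b _ hb
      rw [if_neg]
      intro h
      exact hb (funext fun j => h j (by simp))
    · simp
  obtain ⟨x, -, hx⟩ := Finset.exists_ne_zero_of_sum_ne_zero
    (hsum.trans_ne one_ne_zero)
  have hpath := exists_ne_zero_of_cupList_ne_zero e _ x _ hx
  have hedge : ∀ j, ∃ U : Finset (Fin m), ∃ d ∉ U,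
      diffCochain e (f j) (x + ∑ i ∈ U, e i) d + wrapCochain j (x + ∑ i ∈ U, e i) d ≠ 0 := by
    intro j
    obtain ⟨U, -, d, -, hd, h⟩ := hpath _ (List.mem_map_of_mem (List.mem_finRange j))
    exact ⟨U, d, hd, h⟩
  have hcoord : ∀ (U : Finset (Fin m)) j, (∑ i ∈ U, e i) j = if j ∈ U then 1 else 0 := by
    intro U j
    simp [he, Finset.sum_apply, Pi.single_apply]
  have hne : ∀ j, x j ≠ -1 := by
    intro j hj
    obtain ⟨U, d, hd, h⟩ := hedge j
    apply h
    have hval : ∀ V : Finset (Fin m), f j (x + ∑ i ∈ V, e i) = if j ∈ V then 0 else 1 := by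
      intro V
      by_cases hV : j ∈ V
      · rw [if_pos hV]
        exact hf0 _ _ (by simp [hcoord, hV, hj])
      · rw [if_neg hV]
        exact hf1 _ _ (by simp [hcoord, hV, hj])
    have hstep : x + ∑ i ∈ U, e i + e d = x + ∑ i ∈ insert d U, e i := by
      rw [Finset.sum_insert hd]; abel
    simp only [diffCochain, hstep, hval, wrapCochain, Pi.add_apply, hcoord, hj]
    by_cases hjd : d = j
    · subst hjd
      simp [hd]
      decide
    · have hjd' : j ≠ d := fun h => hjd h.symm
      by_cases hjU : j ∈ U
      · simp [hjd, hjU]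
      · simp [hjd, hjU, hjd']
        decide
  refine ⟨x, hne, fun j => ?_⟩
  obtain ⟨U, d, hd, h⟩ := hedge j
  have hstep : x + ∑ i ∈ U, e i + e d = x + ∑ i ∈ insert d U, e i := by
    rw [Finset.sum_insert hd]; abel
  refine ⟨insert d U, U, fun heq => h ?_⟩
  rw [diffCochain, hstep, heq, CharTwo.add_self_eq_zero, zero_add, wrapCochain, if_neg]
  rintro ⟨rfl, h2⟩
  simp only [Pi.add_apply, hcoord, hd, if_false, add_zero] at h2
  exact hne _ h2

/-- A topological form of Kuhn's lemma: if the set `L j` contains the facet `x j = R` of a cube and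
misses the facet `x j = 0` for each `j`, then some point is in the boundary of every `L j`. -/
theorem exists_mem_closure_inter_closure_compl {m : ℕ} {R : ℝ} (hR : 0 < R)
    (L : Fin m → Set (Fin m → ℝ)) (h0 : ∀ j x, x j = 0 → x ∉ L j)
    (h1 : ∀ j, ∀ x ∈ Set.Icc (0 : Fin m → ℝ) (fun _ => R), x j = R → x ∈ L j) :
    ∃ p ∈ Set.Icc (0 : Fin m → ℝ) (fun _ => R), ∀ j,
      p ∈ closure (L j ∩ Set.Icc 0 (fun _ => R)) ∧
      p ∈ closure ((L j)ᶜ ∩ Set.Icc 0 (fun _ => R)) := by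
  classical
  have hgrid : ∀ M : ℕ, ∃ q ∈ Set.Icc (0 : Fin m → ℝ) (fun _ => R), ∀ j,
      (∃ y ∈ L j ∩ Set.Icc 0 (fun _ => R), dist y q ≤ R / (M + 1)) ∧
      (∃ y ∈ (L j)ᶜ ∩ Set.Icc 0 (fun _ => R), dist y q ≤ R / (M + 1)) := by
    intro M
    have hM : (0 : ℝ) < M + 1 := by positivity
    set g : (Fin m → ZMod (M + 1 + 1)) → Fin m → ℝ :=
      fun x j => R * ((x j).val : ℝ) / (M + 1) with hg
    have hgmem : ∀ x, g x ∈ Set.Icc (0 : Fin m → ℝ) (fun _ => R) := by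
      intro x
      refine ⟨fun j => ?_, fun j => ?_⟩
      · simp only [hg, Pi.zero_apply]; positivity
      · have : ((x j).val : ℝ) ≤ M + 1 := by
          have := ZMod.val_lt (x j)
          exact_mod_cast Nat.lt_succ_iff.1 this
        simp only [hg]
        rw [div_le_iff₀ hM]
        exact mul_le_mul_of_nonneg_left this hR.le
    obtain ⟨x, hx, hUV⟩ := exists_cube_nonconstant (m := m) (M := M + 1)
      (fun j x => if g x ∈ L j then 1 else 0)
      (fun j x hxj => if_neg (h0 j _ (by simp [hg, hxj])))
      (fun j x hxj => if_pos (h1 j _ (hgmem x) (by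
        simp only [hg, hxj]
        rw [ZMod.val_neg_one]
        push_cast
        field_simp)))
    have hdist : ∀ U : Finset (Fin m), dist (g (x + ∑ i ∈ U, Pi.single i 1)) (g x) ≤
        R / (M + 1) := by
      intro U
      refine (dist_pi_le_iff (by positivity)).2 fun j => ?_
      have hcoord : (∑ i ∈ U, Pi.single (M := fun _ => ZMod (M + 1 + 1)) i 1) j =
          if j ∈ U then 1 else 0 := by
        simp [Finset.sum_apply, Pi.single_apply]
      simp only [hg, Pi.add_apply, hcoord]
      split_ifs
      · have hval : (x j + 1).val = (x j).val + 1 := by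
          have hlt : (x j).val < M + 1 := by
            refine lt_of_le_of_ne (Nat.lt_succ_iff.1 (ZMod.val_lt (x j))) fun h => hx j ?_
            apply ZMod.val_injective
            rw [ZMod.val_neg_one, h]
          have hone : (1 : ZMod (M + 1 + 1)).val = 1 := ZMod.val_one'' (by omega)
          rw [ZMod.val_add_of_lt (by rw [hone]; omega), hone]
        rw [hval, Real.dist_eq]
        push_cast
        rw [← sub_div, mul_add, add_sub_cancel_left, mul_one, abs_of_pos (by positivity)]
      · simp only [add_zero, dist_self]
        positivity
    refine ⟨g x, hgmem x, fun j => ?_⟩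
    obtain ⟨U, V, hne⟩ := hUV j
    by_cases hU : g (x + ∑ i ∈ U, Pi.single i 1) ∈ L j
    · have hV : g (x + ∑ i ∈ V, Pi.single i 1) ∉ L j := fun hV => hne (by simp only [hU, hV])
      exact ⟨⟨_, ⟨hU, hgmem _⟩, hdist U⟩, ⟨_, ⟨hV, hgmem _⟩, hdist V⟩⟩
    · have hV : g (x + ∑ i ∈ V, Pi.single i 1) ∈ L j := by
        by_contra hV
        exact hne (by simp only [hU, hV])
      exact ⟨⟨_, ⟨hV, hgmem _⟩, hdist V⟩, ⟨_, ⟨hU, hgmem _⟩, hdist U⟩⟩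
  choose q hq hqL using hgrid
  obtain ⟨p, hp, φ, hφ, hlim⟩ := (isCompact_Icc (a := (0 : Fin m → ℝ))
    (b := fun _ => R)).tendsto_subseq hq
  have hzero : Filter.Tendsto (fun M : ℕ => R / ((φ M : ℝ) + 1)) Filter.atTop (nhds 0) := by
    have := (tendsto_const_div_atTop_nhds_zero_nat R).comp (Filter.tendsto_add_atTop_nat 1)
    have := this.comp hφ.tendsto_atTop
    refine this.congr fun M => ?_
    simp
  have hclosure : ∀ A : Set (Fin m → ℝ), (∀ M, ∃ y ∈ A, dist y (q M) ≤ R / (M + 1)) →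
      p ∈ closure A := by
    intro A hA
    choose y hyA hy using hA
    refine mem_closure_of_tendsto (f := fun M => y (φ M)) (b := Filter.atTop) ?_
      (Filter.Eventually.of_forall fun M => hyA _)
    refine (tendsto_iff_of_dist ?_).2 hlim
    exact squeeze_zero (fun _ => dist_nonneg) (fun M => hy (φ M)) hzero
  exact ⟨p, hp, fun j => ⟨hclosure _ fun M => (hqL M j).1, hclosure _ fun M => (hqL M j).2⟩⟩

/-- A set determined by the signs of finitely many continuous functions is `σ`-compact. -/
theorem isSigmaCompact_of_sign_determined {X I : Type*} [TopologicalSpace X] [SigmaCompactSpace X]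
    [TopologicalSpace.PseudoMetrizableSpace X] [Finite I] {g : I → X → ℝ}
    (hg : ∀ i, Continuous (g i)) {Q : Set X}
    (hQ : ∀ x y, (∀ i, 0 ≤ g i x ↔ 0 ≤ g i y) → x ∈ Q → y ∈ Q) : IsSigmaCompact Q := by
  let _ := TopologicalSpace.pseudoMetrizableSpacePseudoMetric X
  have hcell : ∀ P : Set I, IsSigmaCompact {x | ∀ i, 0 ≤ g i x ↔ i ∈ P} := by
    intro P
    have hF : IsClosed (⋂ i ∈ P, {x | 0 ≤ g i x}) :=
      isClosed_biInter fun i _ => isClosed_le continuous_const (hg i)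
    have hU : IsOpen (⋂ i ∈ Pᶜ, {x | g i x < 0}) :=
      (Set.toFinite Pᶜ).isOpen_biInter fun i _ => isOpen_lt (hg i) continuous_const
    obtain ⟨F, hFc, -, hFU, -⟩ := hU.exists_iUnion_isClosed
    have heq : {x | ∀ i, 0 ≤ g i x ↔ i ∈ P} = ⋃ k, (⋂ i ∈ P, {x | 0 ≤ g i x}) ∩ F k := by
      rw [← Set.inter_iUnion, hFU]
      ext x
      simp only [Set.mem_ofPred_eq, Set.mem_inter_iff, Set.mem_iInter, Set.mem_compl_iff]
      constructor
      · exact fun h => ⟨fun i hi => (h i).2 hi, fun i hi => not_le.1 (mt (h i).1 hi)⟩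
      · rintro ⟨h1, h2⟩ i
        refine ⟨fun h => ?_, h1 i⟩
        by_contra hi
        exact absurd h (not_le.2 (h2 i hi))
    rw [heq]
    exact isSigmaCompact_iUnion _ fun k =>
      isSigmaCompact_univ.of_isClosed_subset (hF.inter (hFc k)) (Set.subset_univ _)
  have heq : Q = ⋃ P : Set I, {x | x ∈ Q ∧ ∀ i, 0 ≤ g i x ↔ i ∈ P} := by
    ext x
    simp only [Set.mem_iUnion, Set.mem_ofPred_eq]
    exact ⟨fun h => ⟨{i | 0 ≤ g i x}, h, fun i => Iff.rfl⟩, fun ⟨_, h, _⟩ => h⟩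
  rw [heq]
  refine isSigmaCompact_iUnion _ fun P => ?_
  rcases Set.eq_empty_or_nonempty {x | x ∈ Q ∧ ∀ i, 0 ≤ g i x ↔ i ∈ P} with h | ⟨y, hyQ, hy⟩
  · rw [h]
    exact isSigmaCompact_empty
  · have : {x | x ∈ Q ∧ ∀ i, 0 ≤ g i x ↔ i ∈ P} = {x | ∀ i, 0 ≤ g i x ↔ i ∈ P} := by
      ext x
      exact ⟨fun h => h.2, fun h => ⟨hQ y x (fun i => (hy i).trans (h i).symm) hyQ, h⟩⟩
    rw [this]
    exact hcell P

theorem IsSigmaCompact.measurableSet {X : Type*} [TopologicalSpace X] [T2Space X]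
    [MeasurableSpace X] [OpensMeasurableSpace X] {Q : Set X} (hQ : IsSigmaCompact Q) :
    MeasurableSet Q := by
  obtain ⟨K, hK, rfl⟩ := hQ
  exact MeasurableSet.iUnion fun k => (hK k).measurableSet

/-- The utility gain of buyer `c.1` from getting `c.2.1` instead of `c.2.2` at prices `p`. -/
def utilGap (v : Fin n → Val m) (p : Fin m → ℝ)
    (c : Fin n × Finset (Fin m) × Finset (Fin m)) : ℝ :=
  (v c.1 c.2.1 - ∑ j ∈ c.2.1, p j) - (v c.1 c.2.2 - ∑ j ∈ c.2.2, p j)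

/-- A family of sets of valuation profiles is comparison based if membership only depends on
the comparisons between the utilities of bundles. -/
def ComparisonBased (A : (Fin m → ℝ) → Set (Fin n → Val m)) : Prop :=
  ∀ p v p' v', (∀ c, 0 ≤ utilGap v p c ↔ 0 ≤ utilGap v' p' c) → v ∈ A p → v' ∈ A p'

theorem ComparisonBased.mem_iff {A : (Fin m → ℝ) → Set (Fin n → Val m)} (hA : ComparisonBased A)
    {p p' : Fin m → ℝ} {v v' : Fin n → Val m}
    (h : ∀ c, 0 ≤ utilGap v p c ↔ 0 ≤ utilGap v' p' c) : v ∈ A p ↔ v' ∈ A p' :=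
  ⟨hA p v p' v' h, hA p' v' p v fun c => (h c).symm⟩

theorem continuous_utilGap {X : Type*} [TopologicalSpace X] {v : X → Fin n → Val m}
    {p : X → Fin m → ℝ} (hv : Continuous v) (hp : Continuous p)
    (c : Fin n × Finset (Fin m) × Finset (Fin m)) : Continuous fun x => utilGap (v x) (p x) c := by
  unfold utilGap
  fun_prop

theorem ComparisonBased.measurableSet {A : (Fin m → ℝ) → Set (Fin n → Val m)}
    (hA : ComparisonBased A) (p : Fin m → ℝ) : MeasurableSet (A p) :=
  (isSigmaCompact_of_sign_determined (g := fun c v => utilGap v p c)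
    (fun c => continuous_utilGap continuous_id continuous_const c)
    fun _ _ h => (hA.mem_iff h).1).measurableSet

theorem ComparisonBased.measurableSet_exists_deviation
    {A : (Fin m → ℝ) → Set (Fin n → Val m)} (hA : ComparisonBased A) (k : ℕ) (r : ℝ) :
    MeasurableSet {z : Fin k → (Fin n → Val m) × (Fin n → Val m) | ∃ p,
      r < |∑ t, (ind (A p) (z t).1 - ind (A p) (z t).2)|} := by
  have h : IsSigmaCompact {y : (Fin k → (Fin n → Val m) × (Fin n → Val m)) × (Fin m → ℝ) |
      r < |∑ t, (ind (A y.2) (y.1 t).1 - ind (A y.2) (y.1 t).2)|} := by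
    refine isSigmaCompact_of_sign_determined
      (I := (Fin k × (Fin n × Finset (Fin m) × Finset (Fin m))) ⊕
        (Fin k × (Fin n × Finset (Fin m) × Finset (Fin m))))
      (g := Sum.elim (fun i y => utilGap (y.1 i.1).1 y.2 i.2)
        (fun i y => utilGap (y.1 i.1).2 y.2 i.2)) ?_ ?_
    · rintro (i | i)
      · exact continuous_utilGap (by fun_prop) continuous_snd i.2
      · exact continuous_utilGap (by fun_prop) continuous_snd i.2
    · intro y y' hyy
      have h1 : ∀ t, ind (A y.2) (y.1 t).1 = ind (A y'.2) (y'.1 t).1 := fun t => by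
        have := hA.mem_iff (p := y.2) (p' := y'.2) (v := (y.1 t).1) (v' := (y'.1 t).1)
          fun c => hyy (Sum.inl (t, c))
        by_cases hm : (y.1 t).1 ∈ A y.2
        · simp [ind, hm, this.1 hm]
        · simp [ind, hm, mt this.2 hm]
      have h2 : ∀ t, ind (A y.2) (y.1 t).2 = ind (A y'.2) (y'.1 t).2 := fun t => by
        have := hA.mem_iff (p := y.2) (p' := y'.2) (v := (y.1 t).2) (v' := (y'.1 t).2)
          fun c => hyy (Sum.inr (t, c))
        by_cases hm : (y.1 t).2 ∈ A y.2
        · simp [ind, hm, this.1 hm]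
        · simp [ind, hm, mt this.2 hm]
      simp only [Set.mem_ofPred_eq, h1, h2, imp_self]
  convert (h.image continuous_fst).measurableSet using 1
  ext z
  simp

open scoped Classical in
theorem ComparisonBased.ncard_range_le {A : (Fin m → ℝ) → Set (Fin n → Val m)}
    (hA : ComparisonBased A) (s : ℕ) (u : Fin s → Fin n → Val m) :
    (Set.range fun p => Finset.univ.filter fun i => u i ∈ A p).ncard ≤
      (s * ((n + 1) * 4 ^ m) + 1) ^ (m + 1) := by
  set G : (Fin m → ℝ) → Finset (Fin s × Fin n × Finset (Fin m) × Finset (Fin m)) := fun p =>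
    Finset.univ.filter fun i => 0 ≤ ∑ j, ((if j ∈ i.2.2.2 then (1 : ℝ) else 0) -
      if j ∈ i.2.2.1 then 1 else 0) * p j + (u i.1 i.2.1 i.2.2.1 - u i.1 i.2.1 i.2.2.2) with hG
  have hGmem : ∀ p i, i ∈ G p ↔ 0 ≤ utilGap (u i.1) p i.2 := by
    intro p i
    simp only [hG, Finset.mem_filter, Finset.mem_univ, true_and]
    have : ∑ j, ((if j ∈ i.2.2.2 then (1 : ℝ) else 0) - if j ∈ i.2.2.1 then 1 else 0) * p j +
        (u i.1 i.2.1 i.2.2.1 - u i.1 i.2.1 i.2.2.2) = utilGap (u i.1) p i.2 := by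
      simp only [sub_mul, Finset.sum_sub_distrib, ite_mul, one_mul, zero_mul, utilGap,
        Finset.sum_ite_mem, Finset.univ_inter]
      ring
    rw [this]
  have hfac : Function.FactorsThrough (fun p => Finset.univ.filter fun i => u i ∈ A p) G := by
    intro p p' h
    ext i
    simp only [Finset.mem_filter, Finset.mem_univ, true_and]
    refine hA.mem_iff fun c => ?_
    rw [← hGmem p (i, c), ← hGmem p' (i, c), h]
  obtain ⟨h, hh⟩ := (Function.factorsThrough_iff _).1 hfac
  rw [hh, Set.range_comp]
  refine (Set.ncard_image_le (Set.toFinite _)).trans ?_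
  refine (ncard_affine_sign_patterns_le _ _).trans ?_
  gcongr
  simp only [Fintype.card_prod, Fintype.card_fin, Fintype.card_finset]
  gcongr
  · omega
  · rw [← mul_pow]
    norm_num

theorem isDemand_iff_utilGap {v : Fin n → Val m} {p : Fin m → ℝ} {M B : Finset (Fin m)}
    (i : Fin n) : IsDemand (v i) p M B ↔ B ⊆ M ∧ ∀ B' ⊆ M, 0 ≤ utilGap v p (i, B, B') := by
  simp only [IsDemand, utilGap, sub_nonneg]

theorem soldSet_congr {sel : Fin n → Val m → (Fin m → ℝ) → Finset (Fin m) → Finset (Fin m)}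
    {p p' : Fin m → ℝ} {v v' : Fin n → Val m}
    (h : ∀ i M, sel i (v i) p M = sel i (v' i) p' M) : soldSet sel p v = soldSet sel p' v' := by
  have havail : ∀ i, availN sel p v i = availN sel p' v' i := by
    intro i
    induction i with
    | zero => rfl
    | succ i ih => simp only [availN, ih, h]
  simp only [soldSet, havail]

/-- The profiles with a buyer having two distinct demand sets at prices `p`. -/
def tieSet (n : ℕ) (p : Fin m → ℝ) : Set (Fin n → Val m) :=
  {v | ∃ (i : Fin n) (M B1 B2 : Finset (Fin m)),
    B1 ≠ B2 ∧ IsDemand (v i) p M B1 ∧ IsDemand (v i) p M B2}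

theorem comparisonBased_tieSet : ComparisonBased (tieSet (m := m) n) := by
  rintro p v p' v' h ⟨i, M, B1, B2, hne, h1, h2⟩
  rw [isDemand_iff_utilGap] at h1 h2
  refine ⟨i, M, B1, B2, hne, ?_, ?_⟩ <;> rw [isDemand_iff_utilGap]
  · exact ⟨h1.1, fun B' hB' => (h _).1 (h1.2 B' hB')⟩
  · exact ⟨h2.1, fun B' hB' => (h _).1 (h2.2 B' hB')⟩

theorem Generic.measure_tieSet {D : Measure (Fin n → Val m)} (hD : Generic D) (p : Fin m → ℝ) :
    D (tieSet n p) = 0 := by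
  have : tieSet n p = ⋃ (i : Fin n) (M : Finset (Fin m)), {v : Fin n → Val m |
      ∃ B1 B2, B1 ≠ B2 ∧ IsDemand (v i) p M B1 ∧ IsDemand (v i) p M B2} := by
    ext v
    simp [tieSet]
  rw [this]
  exact measure_iUnion_null fun i => measure_iUnion_null fun M => hD i p M

theorem comparisonBased_soldSet
    {sel : Fin n → Val m → (Fin m → ℝ) → Finset (Fin m) → Finset (Fin m)}
    (hsel : ∀ i v q M, IsDemand v q M (sel i v q M)) {ρ : Fin n → Finset (Fin m) → ℕ}
    (hρ : ∀ i, Function.Injective (ρ i))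
    (hmax : ∀ i v q M B, IsDemand v q M B → ρ i B ≤ ρ i (sel i v q M)) (j : Fin m) :
    ComparisonBased fun p => {v : Fin n → Val m | j ∈ soldSet sel p v} := by
  intro p v p' v' h hj
  have hdem : ∀ i M B, IsDemand (v i) p M B ↔ IsDemand (v' i) p' M B := by
    intro i M B
    rw [isDemand_iff_utilGap, isDemand_iff_utilGap]
    exact and_congr_right fun _ => forall₂_congr fun B' _ => h _
  have heq : soldSet sel p v = soldSet sel p' v' := by
    refine soldSet_congr fun i M => hρ i (le_antisymm ?_ ?_)
    · exact hmax _ _ _ _ _ ((hdem i M _).1 (hsel _ _ _ _))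
    · exact hmax _ _ _ _ _ ((hdem i M _).2 (hsel _ _ _ _))
  simpa only [Set.mem_ofPred_eq, ← heq] using hj

theorem eventually_soldSet_eq
    {sel : Fin n → Val m → (Fin m → ℝ) → Finset (Fin m) → Finset (Fin m)}
    (hsel : ∀ i v q M, IsDemand v q M (sel i v q M)) {p : Fin m → ℝ} {v : Fin n → Val m}
    (hv : v ∉ tieSet n p) : ∀ᶠ x in nhds p, soldSet sel x v = soldSet sel p v := by
  have hpos : ∀ (i : Fin n) (M B : Finset (Fin m)), B ⊆ M → B ≠ sel i (v i) p M →
      0 < utilGap v p (i, sel i (v i) p M, B) := by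
    intro i M B hBM hne
    have hS := (isDemand_iff_utilGap i).1 (hsel i (v i) p M)
    by_contra hle
    have h0 : utilGap v p (i, sel i (v i) p M, B) = 0 :=
      le_antisymm (not_lt.1 hle) (hS.2 B hBM)
    refine hv ⟨i, M, B, sel i (v i) p M, hne, ?_, hsel i (v i) p M⟩
    refine (isDemand_iff_utilGap i).2 ⟨hBM, fun B' hB' => ?_⟩
    have h1 := hS.2 B' hB'
    simp only [utilGap] at h0 h1 ⊢
    linarith
  have hev : ∀ᶠ x in nhds p, ∀ (i : Fin n) (M B : Finset (Fin m)), B ⊆ M →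
      B ≠ sel i (v i) p M → 0 < utilGap v x (i, sel i (v i) p M, B) := by
    simp only [Filter.eventually_all]
    intro i M B hBM hne
    exact ((continuous_utilGap continuous_const continuous_id _).tendsto p).eventually_const_lt
      (hpos i M B hBM hne)
  filter_upwards [hev] with x hx
  refine soldSet_congr fun i M => ?_
  by_contra hne
  have h1 := hx i M _ (hsel i (v i) x M).1 hne
  have h2 := ((isDemand_iff_utilGap (v := v) i).1 (hsel i (v i) x M)).2 (sel i (v i) p M)
    (hsel i (v i) p M).1
  simp only [utilGap] at h1 h2
  linarith

/-- An item whose price exceeds every marginal value is not sold. -/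
theorem notMem_soldSet_of_lt
    {sel : Fin n → Val m → (Fin m → ℝ) → Finset (Fin m) → Finset (Fin m)}
    (hsel : ∀ i v q M, IsDemand v q M (sel i v q M)) {p : Fin m → ℝ} {v : Fin n → Val m}
    {j : Fin m} (h : ∀ i B, v i B - v i (B.erase j) < p j) : j ∉ soldSet sel p v := by
  have hnot : ∀ i M, j ∉ sel i (v i) p M := by
    intro i M hj
    have hd := hsel i (v i) p M
    have h1 := hd.2 ((sel i (v i) p M).erase j) ((Finset.erase_subset _ _).trans hd.1)
    have h2 := h i (sel i (v i) p M)
    rw [← Finset.add_sum_erase _ _ hj] at h1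
    linarith
  have havail : ∀ i, j ∈ availN sel p v i := by
    intro i
    induction i with
    | zero => simp [availN]
    | succ i ih =>
      simp only [availN]
      split_ifs with hi
      · exact Finset.mem_sdiff.2 ⟨ih, hnot _ _⟩
      · exact ih
  simp [soldSet, havail]

/-- If few samples are tied at any prices, approximate median prices exist for the samples. -/
theorem exists_empirical_median
    {sel : Fin n → Val m → (Fin m → ℝ) → Finset (Fin m) → Finset (Fin m)}
    (hsel : ∀ i v q M, IsDemand v q M (sel i v q M)) {k : ℕ} (S : Fin k → Fin n → Val m) {τ : ℝ}
    (hτ : ∀ p, ∑ t, ind (tieSet n p) (S t) ≤ τ) :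
    ∃ p : Fin m → ℝ, (∀ j, 0 ≤ p j) ∧ ∀ j,
      ∑ t, ind {v | j ∈ soldSet sel p v} (S t) ≤ k / 2 + τ ∧
      (0 < p j → k / 2 - τ ≤ ∑ t, ind {v | j ∈ soldSet sel p v} (S t)) := by
  set X : Fin m → (Fin m → ℝ) → ℝ := fun j p => ∑ t, ind {v | j ∈ soldSet sel p v} (S t) with hX
  obtain ⟨R, hR, hRv⟩ : ∃ R : ℝ, 0 < R ∧
      ∀ t i (B : Finset (Fin m)) j, S t i B - S t i (B.erase j) < R := by
    obtain ⟨R, hR⟩ := (Set.finite_range fun c : Fin k × Fin n × Finset (Fin m) × Fin m =>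
      S c.1 c.2.1 c.2.2.1 - S c.1 c.2.1 (c.2.2.1.erase c.2.2.2)).bddAbove
    refine ⟨max R 0 + 1, by positivity, fun t i B j => ?_⟩
    have h1 := hR (Set.mem_range_self (t, i, B, j))
    have h2 := le_max_left R 0
    simp only at h1
    linarith
  obtain ⟨p, hp, hpL⟩ := exists_mem_closure_inter_closure_compl hR
    (fun j => {x | 0 < x j ∧ X j x ≤ k / 2})
    (fun j x hx h => absurd hx h.1.ne')
    (fun j x _ hx => by
      refine ⟨hx ▸ hR, ?_⟩
      have hz : X j x = 0 := Finset.sum_eq_zero fun t _ => by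
        have : S t ∉ {v : Fin n → Val m | j ∈ soldSet sel x v} :=
          notMem_soldSet_of_lt hsel fun i B => hx ▸ hRv t i B j
        simp only [ind, Set.indicator_of_notMem this]
      rw [hz]
      positivity)
  have hnear : ∀ᶠ x in nhds p, ∀ j, |X j x - X j p| ≤ τ := by
    have hev : ∀ᶠ x in nhds p, ∀ t, S t ∉ tieSet n p →
        soldSet sel x (S t) = soldSet sel p (S t) := by
      simp only [Filter.eventually_all]
      exact fun t ht => eventually_soldSet_eq hsel ht
    filter_upwards [hev] with x hx j
    refine le_trans ?_ (hτ p)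
    simp only [hX, ← Finset.sum_sub_distrib]
    refine (Finset.abs_sum_le_sum_abs _ _).trans (Finset.sum_le_sum fun t _ => ?_)
    by_cases ht : S t ∈ tieSet n p
    · have h1 := ind_mem_Icc {v : Fin n → Val m | j ∈ soldSet sel x v} (S t)
      have h2 := ind_mem_Icc {v : Fin n → Val m | j ∈ soldSet sel p v} (S t)
      have h3 : ind (tieSet n p) (S t) = 1 := by simp [ind, ht]
      rw [h3, abs_le]
      constructor <;> linarith [h1.1, h1.2, h2.1, h2.2]
    · have h3 : ind (tieSet n p) (S t) = 0 := by simp [ind, ht]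
      have h4 : ind {v : Fin n → Val m | j ∈ soldSet sel x v} (S t) =
          ind {v : Fin n → Val m | j ∈ soldSet sel p v} (S t) := by
        simp only [ind, Set.indicator, Set.mem_ofPred_eq, hx t ht]
      rw [h3, h4, sub_self, abs_zero]
  refine ⟨p, hp.1, fun j => ⟨?_, fun hpj => ?_⟩⟩
  · obtain ⟨x, hxL, hx⟩ := ((mem_closure_iff_frequently.1 (hpL j).1).and_eventually hnear).exists
    have h1 := hxL.1.2
    have h2 := (abs_le.1 (hx j)).1
    change X j p ≤ k / 2 + τ
    linarith
  · have hpos : ∀ᶠ x in nhds p, 0 < x j :=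
      ((continuous_apply j).tendsto p).eventually_const_lt hpj
    obtain ⟨x, ⟨hxL, hx⟩, hxj⟩ := (((mem_closure_iff_frequently.1 (hpL j).2).and_eventually
      hnear).and_eventually hpos).exists
    have h1 : k / 2 < X j x := not_le.1 fun h => hxL.1 ⟨hxj, h⟩
    have h2 := (abs_le.1 (hx j)).2
    change k / 2 - τ ≤ X j p
    linarith

theorem empDist_apply {k : ℕ} (hk : 0 < k) (S : Fin k → Fin n → Val m) {A : Set (Fin n → Val m)}
    (hA : MeasurableSet A) : empDist S A = ENNReal.ofReal ((∑ t, ind A (S t)) / k) := by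
  have hk' : (0 : ℝ) < k := by exact_mod_cast hk
  have hsum : ∑ t, A.indicator (1 : (Fin n → Val m) → ℝ≥0∞) (S t) =
      ENNReal.ofReal (∑ t, ind A (S t)) := by
    rw [ENNReal.ofReal_sum_of_nonneg fun t _ => (ind_mem_Icc A (S t)).1]
    refine Finset.sum_congr rfl fun t _ => ?_
    by_cases h : S t ∈ A <;> simp [ind, h]
  rw [empDist, Measure.smul_apply, Measure.finsetSum_apply, smul_eq_mul]
  simp only [Measure.dirac_apply' _ hA]
  rw [hsum, ENNReal.ofReal_div_of_pos hk', ENNReal.ofReal_natCast, mul_comm, div_eq_mul_inv]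

theorem ComparisonBased.measure_deviation_le {D : Measure (Fin n → Val m)}
    [IsProbabilityMeasure D] {A : (Fin m → ℝ) → Set (Fin n → Val m)} (hA : ComparisonBased A)
    {k : ℕ} {ε L : ℝ} (hε : 0 < ε) (hL : Real.log 4 ≤ L)
    (hk : 8192 * (2 * (m + 1) * Real.log (4 * (m + 1) * ((n + 1) * 4 ^ m)) + L) ≤ k * ε ^ 2) :
    (Measure.pi fun _ : Fin k => D)
      {S | ∃ p, k * ε < |∑ t, ind (A p) (S t) - k * D.real (A p)|} ≤
      ENNReal.ofReal (8 * Real.exp (-L)) := by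
  refine measure_uniform_deviation_le D hA.measurableSet (K := (n + 1) * 4 ^ m) (d := m + 1)
    (Nat.one_le_iff_ne_zero.2 (by positivity)) (by omega) hA.ncard_range_le hε hL ?_
    (hA.measurableSet_exists_deviation k _)
  push_cast
  exact hk

theorem log_numerics (hm : 1 ≤ m) {δ : ℝ} (hδ : 0 < δ) (hδ1 : δ < 1) :
    2 * ((m : ℝ) + 1) * Real.log (4 * (m + 1) * ((n + 1) * 4 ^ m)) +
      Real.log (16 * (m + 1) / δ) ≤
      24 * ((m : ℝ) ^ 2 + m * Real.log n + Real.log (1 / δ)) := by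
  have hm' : (1 : ℝ) ≤ m := by exact_mod_cast hm
  have hlog2 : Real.log 2 ≤ 0.7 := by linarith [Real.log_two_lt_d9]
  have hlog4 : Real.log 4 ≤ 1.4 := by
    rw [show (4 : ℝ) = 2 ^ 2 by norm_num, Real.log_pow]
    push_cast
    linarith
  have hlog16 : Real.log 16 ≤ 2.8 := by
    rw [show (16 : ℝ) = 2 ^ 4 by norm_num, Real.log_pow]
    push_cast
    linarith
  have hlogm : Real.log (m + 1) ≤ m := by
    have := Real.log_le_sub_one_of_pos (show (0 : ℝ) < m + 1 by positivity)
    linarith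
  have hlogn0 : 0 ≤ Real.log n := Real.log_natCast_nonneg n
  have hlogn : Real.log (n + 1) ≤ Real.log n + 0.7 := by
    rcases Nat.eq_zero_or_pos n with rfl | hn
    · simp
      norm_num
    · have hn' : (1 : ℝ) ≤ n := by exact_mod_cast hn
      calc Real.log (n + 1) ≤ Real.log (n * 2) :=
            Real.log_le_log (by positivity) (by linarith)
        _ = Real.log n + Real.log 2 := Real.log_mul (by positivity) (by norm_num)
        _ ≤ _ := by linarith
  have hδlog : 0 ≤ Real.log (1 / δ) :=
    Real.log_nonneg (by rw [le_div_iff₀ hδ]; linarith)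
  have h1 : Real.log (4 * (m + 1) * ((n + 1) * 4 ^ m)) =
      Real.log 4 + Real.log (m + 1) + (Real.log (n + 1) + m * Real.log 4) := by
    rw [Real.log_mul (by positivity) (by positivity), Real.log_mul (by positivity) (by positivity),
      Real.log_mul (by positivity) (by positivity), Real.log_pow]
  have h2 : Real.log (16 * (m + 1) / δ) = Real.log 16 + Real.log (m + 1) + Real.log (1 / δ) := by
    rw [show 16 * ((m : ℝ) + 1) / δ = 16 * (m + 1) * (1 / δ) by ring,
      Real.log_mul (by positivity) (by positivity), Real.log_mul (by positivity) (by positivity)]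
  have h3 : Real.log (4 * (m + 1) * ((n + 1) * 4 ^ m)) ≤ 4.5 * m + Real.log n := by
    rw [h1]
    nlinarith
  have h4 : 2 * ((m : ℝ) + 1) * Real.log (4 * (m + 1) * ((n + 1) * 4 ^ m)) ≤
      4 * m * (4.5 * m + Real.log n) := by
    calc _ ≤ 2 * ((m : ℝ) + 1) * (4.5 * m + Real.log n) := by gcongr
      _ ≤ 4 * m * (4.5 * m + Real.log n) := by
        apply mul_le_mul_of_nonneg_right _ (by positivity)
        linarith
  rw [h2]
  have h5 : 0 ≤ m * Real.log n := by positivity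
  nlinarith

/-- Uniform convergence turns empirical medians into medians. -/
theorem isMedian_of_uniform_deviation_le {D : Measure (Fin n → Val m)} [IsProbabilityMeasure D]
    {sel : Fin n → Val m → (Fin m → ℝ) → Finset (Fin m) → Finset (Fin m)} {k : ℕ} (hk : 0 < k)
    {S : Fin k → Fin n → Val m} {ε : ℝ} (hε : 0 < ε) {p : Fin m → ℝ}
    (hmeas : ∀ j, MeasurableSet {v : Fin n → Val m | j ∈ soldSet sel p v})
    (hdev : ∀ j, |∑ t, ind {v | j ∈ soldSet sel p v} (S t) -
      k * D.real {v | j ∈ soldSet sel p v}| ≤ k * ε)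
    (hp : IsMedian (empDist S) sel (1 / 2 - ε) p) : IsMedian D sel (1 / 2 - 2 * ε) p := by
  have hk' : (0 : ℝ) < k := by exact_mod_cast hk
  intro j
  obtain ⟨h1, h2⟩ := hp j
  rw [empDist_apply hk S (hmeas j)] at h1 h2
  rw [← ofReal_measureReal]
  set x := ∑ t, ind {v : Fin n → Val m | j ∈ soldSet sel p v} (S t)
  set y := D.real {v : Fin n → Val m | j ∈ soldSet sel p v}
  have hx : 0 ≤ x := Finset.sum_nonneg fun t _ => (ind_mem_Icc _ _).1
  have hxy : |x / k - y| ≤ ε := by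
    have : x / k - y = (x - k * y) / k := by field_simp
    rw [this, abs_div, abs_of_pos hk', div_le_iff₀ hk']
    linarith [hdev j]
  obtain ⟨h3, h4⟩ := abs_le.1 hxy
  constructor
  · rw [ENNReal.ofReal_le_ofReal_iff (by linarith)] at h1
    exact ENNReal.ofReal_le_ofReal (by linarith)
  · intro hpj
    have h5 := h2 hpj
    rw [ENNReal.ofReal_le_ofReal_iff (by positivity)] at h5
    exact ENNReal.ofReal_le_ofReal (by linarith)

theorem exists_isMedian_empDist
    {sel : Fin n → Val m → (Fin m → ℝ) → Finset (Fin m) → Finset (Fin m)}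
    (hsel : ∀ i v q M, IsDemand v q M (sel i v q M)) {k : ℕ} (hk : 0 < k)
    {S : Fin k → Fin n → Val m} {ε : ℝ}
    (hmeas : ∀ p j, MeasurableSet {v : Fin n → Val m | j ∈ soldSet sel p v})
    (htie : ∀ p, ∑ t, ind (tieSet n p) (S t) ≤ k * ε) :
    ∃ p : Fin m → ℝ, (∀ j, 0 ≤ p j) ∧ IsMedian (empDist S) sel (1 / 2 - ε) p := by
  have hk' : (0 : ℝ) < k := by exact_mod_cast hk
  obtain ⟨p, hp, h⟩ := exists_empirical_median hsel S htie
  refine ⟨p, hp, fun j => ?_⟩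
  rw [empDist_apply hk S (hmeas p j)]
  refine ⟨ENNReal.ofReal_le_ofReal ?_, fun hpj => ENNReal.ofReal_le_ofReal ?_⟩
  · rw [div_le_iff₀ hk']
    linarith [(h j).1]
  · rw [le_div_iff₀ hk']
    linarith [(h j).2 hpj]

/-- There is a universal constant `C` such that for any generic
distribution `D` over valuation profiles (with the sequential posted-price mechanism
resolving ties through a fixed deterministic tie-breaking rule, encoded by the
injective ranking functions `ρ i`, independent of prices and of the available items)
and any `ε, δ > 0`, given `k ≥ C (1/ε²)(m² + m log n + log (1/δ))` i.i.d. sample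
profiles from `D`, with probability at least `1 - δ` over the samples: a
`(1/2 - ε)`-median price vector for the empirical distribution exists, and every
nonnegative price vector that is `(1/2 - ε)`-median for the empirical distribution is
`(1/2 - 2ε)`-median for `D`. -/
theorem stmt13 :
    ∃ C : ℝ, 0 < C ∧
      ∀ (n m : ℕ) (D : Measure (Fin n → Val m)), IsProbabilityMeasure D →
        Generic D →
        ∀ (sel : Fin n → Val m → (Fin m → ℝ) → Finset (Fin m) → Finset (Fin m)),
          (∀ i v q M, IsDemand v q M (sel i v q M)) →
          ∀ ρ : Fin n → Finset (Fin m) → ℕ,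
            (∀ i, Function.Injective (ρ i)) →
            (∀ i v q M B, IsDemand v q M B → ρ i B ≤ ρ i (sel i v q M)) →
            ∀ ε δ : ℝ, 0 < ε → 0 < δ →
              ∀ k : ℕ,
                C * (1 / ε ^ 2) * ((m : ℝ) ^ 2 + m * Real.log n + Real.log (1 / δ)) ≤ k →
                (Measure.pi fun _ : Fin k => D)
                    {S : Fin k → (Fin n → Val m) |
                      (∃ p : Fin m → ℝ, (∀ j, 0 ≤ p j) ∧
                        IsMedian (empDist S) sel (1 / 2 - ε) p) ∧
                      ∀ p : Fin m → ℝ, (∀ j, 0 ≤ p j) →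
                        IsMedian (empDist S) sel (1 / 2 - ε) p →
                          IsMedian D sel (1 / 2 - 2 * ε) p} ≥
                  ENNReal.ofReal (1 - δ) := by
  refine ⟨196608, by norm_num, ?_⟩
  intro n m D hD hgen sel hsel ρ hρ hmax ε δ hε hδ k hk
  rcases le_or_gt 1 δ with hδ1 | hδ1
  · rw [ENNReal.ofReal_of_nonpos (by linarith)]
    exact zero_le
  rcases Nat.eq_zero_or_pos m with rfl | hm
  · refine le_trans (b := (Measure.pi fun _ : Fin k => D) Set.univ) ?_ (measure_mono fun S _ =>
      ⟨⟨fun j => j.elim0, fun j => j.elim0, fun j => j.elim0⟩, fun p _ _ j => j.elim0⟩)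
    rw [measure_univ]
    exact ENNReal.ofReal_le_one.2 (by linarith)
  have hm' : (1 : ℝ) ≤ m := by exact_mod_cast hm
  have hlogn : 0 ≤ Real.log n := Real.log_natCast_nonneg n
  have hlogδ : 0 ≤ Real.log (1 / δ) := Real.log_nonneg (by rw [le_div_iff₀ hδ]; linarith)
  have hkε : 196608 * ((m : ℝ) ^ 2 + m * Real.log n + Real.log (1 / δ)) ≤ k * ε ^ 2 := by
    have := mul_le_mul_of_nonneg_right hk (sq_nonneg ε)
    refine le_trans (le_of_eq ?_) this
    field_simp
  have hk0 : 0 < k := by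
    rcases Nat.eq_zero_or_pos k with rfl | h
    · have : 0 ≤ m * Real.log n := by positivity
      simp only [Nat.cast_zero, zero_mul] at hkε
      nlinarith
    · exact h
  set L : ℝ := Real.log (16 * (m + 1) / δ) with hL
  have hL4 : Real.log 4 ≤ L := Real.log_le_log (by norm_num) (by
    rw [le_div_iff₀ hδ]
    linarith)
  have hnum : 8192 * (2 * ((m : ℝ) + 1) * Real.log (4 * (m + 1) * ((n + 1) * 4 ^ m)) + L) ≤
      k * ε ^ 2 := by
    have := log_numerics (n := n) hm hδ hδ1
    linarith
  have hsold := comparisonBased_soldSet hsel hρ hmax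
  set P := Measure.pi fun _ : Fin k => D
  set bad : Option (Fin m) → Set (Fin k → Fin n → Val m) := fun o =>
    {S | ∃ p, k * ε < |∑ t, ind (o.elim (tieSet n p) fun j => {v | j ∈ soldSet sel p v}) (S t) -
      k * D.real (o.elim (tieSet n p) fun j => {v | j ∈ soldSet sel p v})|} with hbad
  have hbadle : ∀ o, P (bad o) ≤ ENNReal.ofReal (8 * Real.exp (-L)) := by
    rintro (_ | j)
    · exact comparisonBased_tieSet.measure_deviation_le hε hL4 hnum
    · exact (hsold j).measure_deviation_le hε hL4 hnum
  have hunion : P (⋃ o, bad o) ≤ ENNReal.ofReal δ := by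
    calc P (⋃ o, bad o) ≤ ∑ o, P (bad o) := measure_iUnion_fintype_le _ _
      _ ≤ ∑ _o : Option (Fin m), ENNReal.ofReal (8 * Real.exp (-L)) :=
        Finset.sum_le_sum fun o _ => hbadle o
      _ = ENNReal.ofReal ((m + 1) * (8 * Real.exp (-L))) := by
        rw [Finset.sum_const, Finset.card_univ, Fintype.card_option, Fintype.card_fin,
          nsmul_eq_mul, ← ENNReal.ofReal_natCast, ← ENNReal.ofReal_mul (by positivity)]
        push_cast
        rfl
      _ ≤ ENNReal.ofReal δ := by
        apply ENNReal.ofReal_le_ofReal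
        rw [Real.exp_neg, hL, Real.exp_log (by positivity)]
        field_simp
        norm_num
  set good := {S : Fin k → (Fin n → Val m) |
    (∃ p : Fin m → ℝ, (∀ j, 0 ≤ p j) ∧ IsMedian (empDist S) sel (1 / 2 - ε) p) ∧
    ∀ p : Fin m → ℝ, (∀ j, 0 ≤ p j) → IsMedian (empDist S) sel (1 / 2 - ε) p →
      IsMedian D sel (1 / 2 - 2 * ε) p} with hgood
  have hcover : Set.univ ⊆ good ∪ ⋃ o, bad o := by
    intro S _
    by_cases hS : S ∈ ⋃ o, bad o
    · exact Or.inr hS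
    left
    have hdev : ∀ (o : Option (Fin m)) p, |∑ t, ind (o.elim (tieSet n p) fun j => {v | j ∈ soldSet sel p v}) (S t) -
        k * D.real (o.elim (tieSet n p) fun j => {v | j ∈ soldSet sel p v})| ≤ k * ε := by
      intro o p
      by_contra h
      exact hS (Set.mem_iUnion.2 ⟨o, p, not_le.1 h⟩)
    refine ⟨exists_isMedian_empDist hsel hk0 (fun p j => (hsold j).measurableSet p) fun p => ?_,
      fun p _ hp => isMedian_of_uniform_deviation_le hk0 hε (fun j => (hsold j).measurableSet p)
        (fun j => hdev (some j) p) hp⟩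
    have h := hdev none p
    simp only [Option.elim_none, Measure.real, hgen.measure_tieSet p, ENNReal.toReal_zero,
      mul_zero, sub_zero] at h
    exact (le_abs_self _).trans h
  have hone : 1 ≤ P good + ENNReal.ofReal δ := by
    calc (1 : ℝ≥0∞) = P Set.univ := measure_univ.symm
      _ ≤ P (good ∪ ⋃ o, bad o) := measure_mono hcover
      _ ≤ P good + P (⋃ o, bad o) := measure_union_le _ _
      _ ≤ _ := by gcongr
  rw [ge_iff_le, ENNReal.ofReal_sub _ hδ.le, ENNReal.ofReal_one]
  exact tsub_le_iff_right.2 hone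
end

section
/- Given any distribution D over valuations and any ε > 0, there exists a generic distribution D' over valuations and a coupling F between D and D' such that for every pair (v, v') drawn from F, |v(S) − v'(S)| < ε for all S ⊆ [m]. In particular, the distribution D' obtained by drawing v ~ D, drawing w_j uniformly and independently from [0, ε/m] for each item j, and setting v'(S) = v(S) + Σ_{j∈S} w_j, is generic. -/
open scoped BigOperators

open MeasureTheory
open scoped ENNReal

/-- The uniform distribution on the interval `[0, c]`. -/
noncomputable def unifIcc (c : ℝ) : Measure ℝ :=
  (volume (Set.Icc (0 : ℝ) c))⁻¹ • volume.restrict (Set.Icc (0 : ℝ) c)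

/-- Perturbing a valuation additively by the item weights `w`:
`v'(S) = v(S) + Σ_{j ∈ S} w j`. -/
def perturb {m : ℕ} (x : Val m × (Fin m → ℝ)) : Val m :=
  fun S => x.1 S + ∑ j ∈ S, x.2 j

/-- A product measure gives mass zero to an affine hyperplane that is not parallel to some axis
along which the factor has no atoms. -/
theorem pi_sum_mul_eq_null {m : ℕ} (μ : Fin m → Measure ℝ) [∀ i, SigmaFinite (μ i)] (j : Fin m)
    [NullSingletonClass (μ j)] (a : Fin m → ℝ) (ha : a j ≠ 0) (t : ℝ) :
    Measure.pi μ {w | ∑ i, a i * w i = t} = 0 := by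
  obtain _ | n := m
  · exact j.elim0
  have hs : MeasurableSet {x : ℝ × (Fin n → ℝ) |
      a j * x.1 + ∑ i, a (j.succAbove i) * x.2 i = t} :=
    measurableSet_eq_fun (by fun_prop) measurable_const
  have hpre : {w : Fin (n + 1) → ℝ | ∑ i, a i * w i = t} =
      MeasurableEquiv.piFinSuccAbove (fun _ => ℝ) j ⁻¹'
        {x | a j * x.1 + ∑ i, a (j.succAbove i) * x.2 i = t} := by
    ext w
    simp [Fin.sum_univ_succAbove _ j, MeasurableEquiv.piFinSuccAbove, Fin.insertNthEquiv,
      Fin.removeNth]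
  rw [hpre, (measurePreserving_piFinSuccAbove μ j).measure_preimage hs.nullMeasurableSet,
    Measure.prod_apply_symm hs, lintegral_eq_zero_of_ae_eq_zero]
  refine Filter.Eventually.of_forall fun y => ?_
  refine measure_mono_null (t := {(t - ∑ i, a (j.succAbove i) * y i) / a j}) ?_
    (measure_singleton _)
  intro x hx
  simp only [Set.mem_preimage, Set.mem_ofPred_eq] at hx
  rw [Set.mem_singleton_iff, eq_div_iff ha]
  linarith

theorem isProbabilityMeasure_unifIcc {c : ℝ} (hc : 0 < c) : IsProbabilityMeasure (unifIcc c) := by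
  constructor
  simp only [unifIcc, Measure.smul_apply, Measure.restrict_apply_univ, smul_eq_mul]
  exact ENNReal.inv_mul_cancel (by simp [hc]) (by simp)

instance nullSingletonClass_unifIcc (c : ℝ) : NullSingletonClass (unifIcc c) :=
  ⟨fun x => by simp [unifIcc]⟩

theorem ae_unifIcc_mem_Icc (c : ℝ) : ∀ᵐ x ∂unifIcc c, x ∈ Set.Icc (0 : ℝ) c :=
  Measure.ae_smul_measure (ae_restrict_mem measurableSet_Icc) _

theorem measurable_perturb {m : ℕ} : Measurable (perturb (m := m)) := by
  unfold perturb
  fun_prop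

theorem generic1_map_perturb {m : ℕ} (D : Measure (Val m)) [SFinite D]
    (μ : Fin m → Measure ℝ) [∀ i, SigmaFinite (μ i)] [∀ i, NullSingletonClass (μ i)] :
    Generic1 (Measure.map perturb (D.prod (Measure.pi μ))) := by
  classical
  intro q M
  have htie : ∀ B1 B2 : Finset (Fin m), B1 ≠ B2 →
      Measure.map perturb (D.prod (Measure.pi μ))
        {v | v B1 - ∑ j ∈ B1, q j = v B2 - ∑ j ∈ B2, q j} = 0 := by
    intro B1 B2 hB
    have hs : MeasurableSet {v : Val m | v B1 - ∑ j ∈ B1, q j = v B2 - ∑ j ∈ B2, q j} :=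
      measurableSet_eq_fun (by fun_prop) (by fun_prop)
    rw [Measure.map_apply measurable_perturb hs, Measure.measure_prod_null (measurable_perturb hs)]
    refine Filter.Eventually.of_forall fun v => ?_
    obtain ⟨j, hj⟩ : ∃ j, ¬(j ∈ B1 ↔ j ∈ B2) := by
      by_contra! h
      exact hB (Finset.ext h)
    refine measure_mono_null ?_ (pi_sum_mul_eq_null μ j
      (fun i => (if i ∈ B1 then 1 else 0) - (if i ∈ B2 then 1 else 0)) (by grind)
      (v B2 - ∑ j ∈ B2, q j - (v B1 - ∑ j ∈ B1, q j)))
    intro w hw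
    simp only [perturb, Set.mem_preimage, Set.mem_ofPred_eq] at hw
    simp only [Set.mem_ofPred_eq, sub_mul, ite_mul, one_mul, zero_mul, Finset.sum_sub_distrib,
      Finset.sum_ite_mem, Finset.univ_inter]
    linarith
  refine measure_mono_null (t := ⋃ B1 : Finset (Fin m), ⋃ B2 : Finset (Fin m), ⋃ _ : B1 ≠ B2,
    {v : Val m | v B1 - ∑ j ∈ B1, q j = v B2 - ∑ j ∈ B2, q j}) ?_ ?_
  · rintro v ⟨B1, B2, hB, h1, h2⟩
    simp only [Set.mem_iUnion]
    exact ⟨B1, B2, hB, le_antisymm (h2.2 B1 h1.1) (h1.2 B2 h2.1)⟩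
  · simpa only [measure_iUnion_null_iff] using htie

/-- Given any distribution `D` over valuations and any `ε > 0`,
there is a generic distribution `D'` and a coupling `F` of `D` and `D'` such that
almost surely a pair `(v, v') ~ F` satisfies `|v(S) - v'(S)| < ε` for every bundle
`S`.  In particular, the distribution `D'` obtained by drawing `v ~ D`, drawing
`w j ~ U[0, ε/m]` independently for each item `j`, and setting
`v'(S) = v(S) + Σ_{j ∈ S} w j`, is generic. -/
theorem stmt19 (m : ℕ) (D : Measure (Val m)) [IsProbabilityMeasure D]
    (hval : ∀ᵐ v ∂D, IsValuation v) (ε : ℝ) (hε : 0 < ε) :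
    (∃ (D' : Measure (Val m)) (F : Measure (Val m × Val m)),
      IsProbabilityMeasure D' ∧ IsProbabilityMeasure F ∧
      F.map Prod.fst = D ∧ F.map Prod.snd = D' ∧ Generic1 D' ∧
      ∀ᵐ x ∂F, ∀ S : Finset (Fin m), |x.1 S - x.2 S| < ε) ∧
    Generic1 (Measure.map perturb
      (D.prod (Measure.pi fun _ : Fin m => unifIcc (ε / m)))) := by
  constructor
  · have hm : (0 : ℝ) < m + 1 := by positivity
    have hc : 0 < ε / (m + 1) := by positivity
    have := isProbabilityMeasure_unifIcc hc
    set P := D.prod (Measure.pi fun _ : Fin m => unifIcc (ε / (m + 1)))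
    have hpair : Measurable fun x : Val m × (Fin m → ℝ) => (x.1, perturb x) :=
      measurable_fst.prodMk measurable_perturb
    refine ⟨P.map perturb, P.map fun x => (x.1, perturb x),
      Measure.isProbabilityMeasure_map measurable_perturb.aemeasurable,
      Measure.isProbabilityMeasure_map hpair.aemeasurable, ?_, ?_, generic1_map_perturb _ _, ?_⟩
    · rw [Measure.map_map measurable_fst hpair]
      exact Measure.map_fst_prod.trans (by simp)
    · rw [Measure.map_map measurable_snd hpair]
      rfl
    · have hmeas : MeasurableSet
          {x : Val m × Val m | ∀ S : Finset (Fin m), |x.1 S - x.2 S| < ε} := by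
        rw [Set.ofPred_forall]
        exact MeasurableSet.iInter fun S => measurableSet_lt (by fun_prop) measurable_const
      rw [ae_map_iff hpair.aemeasurable hmeas]
      have hw : ∀ᵐ w ∂(Measure.pi fun _ : Fin m => unifIcc (ε / (m + 1))),
          ∀ j, w j ∈ Set.Icc 0 (ε / (m + 1)) :=
        ae_all_iff.2 fun j => Measure.tendsto_eval_ae_ae.eventually (ae_unifIcc_mem_Icc _)
      filter_upwards [Measure.quasiMeasurePreserving_snd.ae hw] with x hx S
      have h0 : 0 ≤ ∑ j ∈ S, x.2 j := Finset.sum_nonneg fun j _ => (hx j).1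
      have hS : (S.card : ℝ) ≤ m := by exact_mod_cast S.card_le_univ.trans_eq (Fintype.card_fin m)
      have h1 : ∑ j ∈ S, x.2 j ≤ S.card * (ε / (m + 1)) := by
        simpa using Finset.sum_le_card_nsmul S x.2 _ fun j _ => (hx j).2
      have h2 : (m + 1) * (ε / (m + 1)) = ε := mul_div_cancel₀ ε hm.ne'
      have h3 : S.card * (ε / (m + 1)) ≤ m * (ε / (m + 1)) := by gcongr
      simp only [perturb]
      rw [sub_add_cancel_left, abs_neg, abs_of_nonneg h0]
      linarith
  · have hprob : ∀ _ : Fin m, IsProbabilityMeasure (unifIcc (ε / m)) := fun j =>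
      isProbabilityMeasure_unifIcc (div_pos hε (by exact_mod_cast j.pos))
    exact generic1_map_perturb _ _
end
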